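/- arXiv:2603.23046 — 3 statements merged into one kernel-verified Lean document; each statement's English description precedes it below -/
import Mathlib

section
/- Suppose Assumption 1 holds, f ∈ S⁰_{μ_f}(X) and g ∈ S⁰_{μ_g}(Y) with μ_f, μ_g ≥ 0, β_k → ∞, (ε_k) is nonincreasing with ε_k ≥ 0 and Σ_{k=1}^{∞} α_kβ_kε_k < +∞, and let (x_k, y_k, λ_k) be generated by the scheme (disc) with the implicit multiplier choice λ̄_{k+1} = λ̂_{k+1} = λ_{k+1} (Algorithm 1). Let (x*,y*,λ*) be a saddle point of L. Then the sequence (x_k, y_k, λ_k) is bounded, and there exists a constant C > 0 such that for all k ≥ 1: L(x_k, y_k, λ*) − L(x*, y*, λ*) ≤ C/β_k, |Φ(x_k, y_k) − Φ(x*, y*)| ≤ C/β_k, and ‖Ax_k + By_k − b‖ ≤ C/β_k. -/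
open Filter Topology
open scoped RealInnerProductSpace

/-- One step of the implicit scheme decreases the part of the energy belonging to one primal
block, up to the coupling term with the multiplier and the regularization error. -/
theorem block_energy_step {E : Type*} [NormedAddCommGroup E] [InnerProductSpace ℝ E]
    {F : E → ℝ} {x x' w w' z z' u p c : E} {α β δ γ ε μ : ℝ}
    (hα : 0 < α) (hβ : 0 < β) (hδ : 0 < δ) (hε : 0 ≤ ε) (hμ : 0 ≤ μ) (hδγ : δ * γ - 1 ≥ 0)
    (hz' : z' = (1 / α) • (x' - x) + γ • x')
    (hw : w = δ • z + (1 - δ * γ) • x) (hw' : w' = δ • z' + (1 - δ * γ) • x')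
    (hstep : (1 / α) • (z' - z) = -(β • (u + p + ε • x' - μ • (x' - w'))))
    (hu : F x - F x' ≥ ⟪u, x - x'⟫)
    (hS : F c - F x' - ⟪u, c - x'⟫ ≥ μ / 2 * ‖c - x'‖ ^ 2) :
    ‖w' - c‖ ^ 2 / 2 + (δ * γ - 1) / 2 * ‖x' - c‖ ^ 2 + δ ^ 2 * β * ε / 2 * ‖x'‖ ^ 2
        + δ ^ 2 * β * F x' + δ * α * β * (F x' - F c) + δ * α * β * ⟪p, w' - c⟫
        + δ * α * β * ε / 2 * ‖x'‖ ^ 2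
      ≤ ‖w - c‖ ^ 2 / 2 + (δ * γ - 1) / 2 * ‖x - c‖ ^ 2 + δ ^ 2 * β * ε / 2 * ‖x‖ ^ 2
        + δ ^ 2 * β * F x + δ * α * β * ε / 2 * ‖c‖ ^ 2 := by
  obtain ⟨d, hd⟩ : ∃ d : E, d = (1 / α) • (x' - x) := ⟨_, rfl⟩
  have hx : x = x' - α • d := by
    rw [hd, smul_smul, mul_one_div_cancel hα.ne', one_smul]; abel
  have hw'd : w' = x' + δ • d := by
    rw [hw', hz', ← hd]; module
  obtain ⟨m, hm⟩ : ∃ m : E, m = -((δ * α * β) • (u + p + ε • x' + (μ * δ) • d))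
      - ((δ * γ - 1) * α) • d := ⟨_, rfl⟩
  have hzz : z' - z = -((α * β) • (u + p + ε • x' + (μ * δ) • d)) := by
    have h := congrArg (fun t => α • t) hstep
    simp only [smul_smul, mul_one_div_cancel hα.ne', one_smul] at h
    rw [h, hw'd]; module
  have hwm : w = w' - m := by
    have hz : z = z' + (α * β) • (u + p + ε • x' + (μ * δ) • d) := by
      rw [← sub_eq_iff_eq_add', ← neg_sub, hzz, neg_neg]
    rw [hw, hw', hm, hz, hx]; module
  have h1 : ‖w' - c‖ ^ 2 / 2 - ⟪m, w' - c⟫ ≤ ‖w - c‖ ^ 2 / 2 := by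
    have e : w - c = (w' - c) - m := by rw [hwm]; abel
    rw [e, norm_sub_sq_real (w' - c) m, real_inner_comm m (w' - c)]
    nlinarith [sq_nonneg ‖m‖]
  obtain ⟨r, hr⟩ : ∃ r : E, r = x' - c := ⟨_, rfl⟩
  have hc : c = x' - r := by rw [hr]; abel
  have hwr : w' - c = r + δ • d := by rw [hw'd, hr]; abel
  have hxr : x - c = r - α • d := by rw [hx, hr]; abel
  have e1 : c - x' = -r := by rw [hr]; abel
  have e2 : x - x' = -(α • d) := by rw [hx]; abel
  rw [e1] at hS
  rw [e2] at hu
  rw [hxr, ← hr]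
  rw [hwr] at h1 ⊢
  have k1 := mul_nonneg (mul_nonneg (mul_nonneg hδ.le hα.le) hβ.le) (sub_nonneg.2 hS)
  have k2 := mul_nonneg (mul_nonneg (sq_nonneg δ) hβ.le) (sub_nonneg.2 hu)
  have k3 : 0 ≤ (δ * γ - 1) / 2 * α ^ 2 * ‖d‖ ^ 2 + (δ * γ - 1) * α * δ * ‖d‖ ^ 2 := by
    have : 0 ≤ δ * γ - 1 := hδγ
    positivity
  have k4 : 0 ≤ δ * α * β * ε / 2 * ‖r‖ ^ 2 + δ ^ 2 * β * ε / 2 * α ^ 2 * ‖d‖ ^ 2 := by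
    positivity
  have k5 : 0 ≤ δ * α * β * (μ / 2) * (‖r + δ • d‖ ^ 2 + δ ^ 2 * ‖d‖ ^ 2) := by positivity
  have ecn : ‖c‖ ^ 2 = ‖x' - r‖ ^ 2 := by rw [← hc]
  rw [ecn, hx, hm] at *
  simp only [← real_inner_self_eq_norm_sq, inner_add_left, inner_sub_left, inner_neg_left,
    inner_neg_right, inner_add_right, inner_sub_right, real_inner_smul_left,
    real_inner_smul_right] at *
  rw [real_inner_comm r x', real_inner_comm d x', real_inner_comm r d] at *
  linarith

/-- A sequence of successive averages of its predecessor with points of a ball around the origin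
stays in that ball. -/
theorem norm_le_of_averaging {E : Type*} [NormedAddCommGroup E] [NormedSpace ℝ E]
    {p q : ℕ → E} {c : ℕ → ℝ} {M : ℝ} (hc : ∀ k, 1 ≤ k → 0 ≤ c k) (h1 : ‖p 1‖ ≤ M)
    (hq : ∀ k, 1 ≤ k → ‖q k‖ ≤ M)
    (hp : ∀ k, 1 ≤ k → (1 + c k) • p (k + 1) = p k + c k • q (k + 1)) :
    ∀ k, 1 ≤ k → ‖p k‖ ≤ M := by
  intro k hk
  induction k, hk using Nat.le_induction with
  | base => exact h1
  | succ k hk ih =>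
    have hck := hc k hk
    have h := congrArg norm (hp k hk)
    rw [norm_smul, Real.norm_of_nonneg (by positivity)] at h
    have h2 : ‖p k + c k • q (k + 1)‖ ≤ M + c k * M := by
      refine (norm_add_le _ _).trans ?_
      rw [norm_smul, Real.norm_of_nonneg hck]
      gcongr
      exact hq _ (by omega)
    refine le_of_mul_le_mul_left ?_ (show 0 < 1 + c k by positivity)
    linarith

/-- A sequence on `k ≥ 1` whose increments are dominated by a summable sequence is bounded
above. -/
theorem exists_bound_of_le_add_summable {E e : ℕ → ℝ} (he : Summable e)
    (henn : ∀ k, 1 ≤ k → 0 ≤ e k) (hE : ∀ k, 1 ≤ k → E (k + 1) ≤ E k + e k) :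
    ∃ K : ℝ, ∀ k, 1 ≤ k → E k ≤ K := by
  have hs : Summable fun n => e (n + 1) := (summable_nat_add_iff 1).2 he
  have hE' : ∀ n, E (n + 1) ≤ E 1 + ∑ i ∈ Finset.range n, e (i + 1) := by
    intro n
    induction n with
    | zero => simp
    | succ n ih =>
      rw [Finset.sum_range_succ]
      linarith [hE (n + 1) (by omega)]
  refine ⟨E 1 + ∑' n, e (n + 1), fun k hk => ?_⟩
  obtain ⟨n, rfl⟩ : ∃ n, k = n + 1 := ⟨k - 1, by omega⟩
  linarith [hE' n, hs.sum_le_tsum (Finset.range n) fun i _ => henn (i + 1) (by omega)]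

theorem convergence_rates_algorithm1
    {X Y Z : Type*}
    [NormedAddCommGroup X] [InnerProductSpace ℝ X] [CompleteSpace X]
    [NormedAddCommGroup Y] [InnerProductSpace ℝ Y] [CompleteSpace Y]
    [NormedAddCommGroup Z] [InnerProductSpace ℝ Z] [CompleteSpace Z]
    (f : X → ℝ) (g : Y → ℝ)
    (hfconv : ConvexOn ℝ Set.univ f) (hfcont : Continuous f)
    (hgconv : ConvexOn ℝ Set.univ g) (hgcont : Continuous g)
    (A : X →L[ℝ] Z) (B : Y →L[ℝ] Z) (b : Z)
    (μf μg : ℝ) (hμf : 0 ≤ μf) (hμg : 0 ≤ μg)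
    (hfS : ∀ x u v : X, (∀ w, f w - f x ≥ ⟪v, w - x⟫) →
        f u - f x - ⟪v, u - x⟫ ≥ μf / 2 * ‖u - x‖ ^ 2)
    (hgS : ∀ y u v : Y, (∀ w, g w - g y ≥ ⟪v, w - y⟫) →
        g u - g y - ⟪v, u - y⟫ ≥ μg / 2 * ‖u - y‖ ^ 2)
    (L : X → Y → Z → ℝ)
    (hL : ∀ x y l, L x y l = f x + g y + ⟪l, A x + B y - b⟫)
    (δ γ : ℝ) (hδ : 0 < δ) (hγ : 0 < γ)
    (α β ε : ℕ → ℝ)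
    (hα : ∀ k, 1 ≤ k → 0 < α k)
    (hβpos : ∀ k, 1 ≤ k → 0 < β k)
    (hβmono : ∀ k, 1 ≤ k → β k ≤ β (k + 1))
    (hεnn : ∀ k, 1 ≤ k → 0 ≤ ε k)
    (hβtop : Tendsto β atTop atTop)
    (x : ℕ → X) (y : ℕ → Y) (lam : ℕ → Z)
    (Zs Zd : ℕ → X) (Hs Hd : ℕ → Y)
    (hZ : ∀ k, 1 ≤ k → Zs (k + 1) = (1 / α k) • (x (k + 1) - x k) + γ • x (k + 1))
    (hZd : ∀ k, 1 ≤ k → Zd (k + 1) = δ • Zs (k + 1) + (1 - δ * γ) • x (k + 1))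
    (hH : ∀ k, 1 ≤ k → Hs (k + 1) = (1 / α k) • (y (k + 1) - y k) + γ • y (k + 1))
    (hHd : ∀ k, 1 ≤ k → Hd (k + 1) = δ • Hs (k + 1) + (1 - δ * γ) • y (k + 1))
    (hlam : ∀ k, 1 ≤ k → lam (k + 1) = lam k + (α k * β k) • (A (Zd (k + 1)) + B (Hd (k + 1)) - b))
    (hstep : ∀ k, 1 ≤ k → ∃ u v,
        (∀ w, f w - f (x (k + 1)) ≥ ⟪u, w - x (k + 1)⟫) ∧
        (∀ w, g w - g (y (k + 1)) ≥ ⟪v, w - y (k + 1)⟫) ∧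
        (1 / α k) • (Zs (k + 1) - Zs k) =
          -(β k • (u + (ContinuousLinearMap.adjoint A) (lam (k + 1)) + ε k • x (k + 1)
              - μf • (x (k + 1) - Zd (k + 1)))) ∧
        (1 / α k) • (Hs (k + 1) - Hs k) =
          -(β k • (v + (ContinuousLinearMap.adjoint B) (lam (k + 1)) + ε k • y (k + 1)
              - μg • (y (k + 1) - Hd (k + 1)))))
    (hδγ : δ * γ - 1 ≥ 0)
    (hββ : ∀ k, 1 ≤ k → δ * β (k + 1) ≤ δ * β k + α k * β k)
    (hεmono : ∀ k, 1 ≤ k → ε (k + 1) ≤ ε k)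
    (hsum : Summable (fun k => α k * β k * ε k))
    (xs : X) (ys : Y) (ls : Z)
    (hsaddle : ∀ x' y' l', L xs ys l' ≤ L xs ys ls ∧ L xs ys ls ≤ L x' y' ls)
    :
    (∃ M : ℝ, ∀ k, 1 ≤ k → ‖x k‖ ≤ M ∧ ‖y k‖ ≤ M ∧ ‖lam k‖ ≤ M) ∧
    ∃ C : ℝ, 0 < C ∧ ∀ k, 1 ≤ k →
      L (x k) (y k) ls - L xs ys ls ≤ C / β k ∧
      |f (x k) + g (y k) - (f xs + g ys)| ≤ C / β k ∧
      ‖A (x k) + B (y k) - b‖ ≤ C / β k := by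
  have hfeas : A xs + B ys - b = 0 := by
    have h := (hsaddle xs ys (ls + (A xs + B ys - b))).1
    rw [hL, hL, inner_add_left, real_inner_self_eq_norm_sq] at h
    have h0 : ‖A xs + B ys - b‖ ^ 2 ≤ 0 := by linarith
    simpa using le_antisymm h0 (sq_nonneg _)
  have hb : b = A xs + B ys := (sub_eq_zero.1 hfeas).symm
  have hLs : L xs ys ls = f xs + g ys := by rw [hL, hfeas, inner_zero_right, add_zero]
  obtain ⟨w, hw⟩ : ∃ w : ℕ → X, ∀ k, w k = δ • Zs k + (1 - δ * γ) • x k := ⟨_, fun _ => rfl⟩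
  obtain ⟨h, hh⟩ : ∃ h : ℕ → Y, ∀ k, h k = δ • Hs k + (1 - δ * γ) • y k := ⟨_, fun _ => rfl⟩
  obtain ⟨s, hs⟩ : ∃ s : ℕ → Z, ∀ k, s k = A (x k) + B (y k) - b := ⟨_, fun _ => rfl⟩
  obtain ⟨G, hG⟩ : ∃ G : ℕ → ℝ, ∀ k, G k = L (x k) (y k) ls - L xs ys ls := ⟨_, fun _ => rfl⟩
  have hGnn : ∀ k, 0 ≤ G k := fun k => by
    rw [hG]; linarith [(hsaddle (x k) (y k) ls).2]
  have hGe : ∀ k, G k = f (x k) + g (y k) - (f xs + g ys) + ⟪ls, s k⟫ := fun k => by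
    rw [hG, hLs, hL, hs]; ring
  have hZdw : ∀ k, 1 ≤ k → Zd (k + 1) = w (k + 1) := fun k hk => by rw [hZd k hk, hw]
  have hHdh : ∀ k, 1 ≤ k → Hd (k + 1) = h (k + 1) := fun k hk => by rw [hHd k hk, hh]
  have hwx : ∀ k, 1 ≤ k → α k • w (k + 1) = α k • x (k + 1) + δ • (x (k + 1) - x k) :=
    fun k hk => by
      have e : w (k + 1) = x (k + 1) + δ • ((1 / α k) • (x (k + 1) - x k)) := by
        rw [hw, hZ k hk]; module
      rw [e, smul_add, smul_comm (α k) δ, smul_smul (α k), mul_one_div_cancel (hα k hk).ne',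
        one_smul]
  have hhy : ∀ k, 1 ≤ k → α k • h (k + 1) = α k • y (k + 1) + δ • (y (k + 1) - y k) :=
    fun k hk => by
      have e : h (k + 1) = y (k + 1) + δ • ((1 / α k) • (y (k + 1) - y k)) := by
        rw [hh, hH k hk]; module
      rw [e, smul_add, smul_comm (α k) δ, smul_smul (α k), mul_one_div_cancel (hα k hk).ne',
        one_smul]
  have hσ : ∀ k, 1 ≤ k → α k • (A (w (k + 1)) + B (h (k + 1)) - b)
      = α k • s (k + 1) + δ • (s (k + 1) - s k) := fun k hk => by
    rw [smul_sub, smul_add, ← map_smul, ← map_smul, hwx k hk, hhy k hk, hs, hs]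
    simp only [map_add, map_smul, map_sub]
    module
  have hlam' : ∀ k, 1 ≤ k →
      lam (k + 1) = lam k + β k • (α k • s (k + 1) + δ • (s (k + 1) - s k)) := fun k hk => by
    rw [hlam k hk, hZdw k hk, hHdh k hk, mul_comm, mul_smul, hσ k hk]
  obtain ⟨E, hE⟩ : ∃ E : ℕ → ℝ, ∀ k, E k =
      ‖w k - xs‖ ^ 2 / 2 + ‖h k - ys‖ ^ 2 / 2
      + (δ * γ - 1) / 2 * (‖x k - xs‖ ^ 2 + ‖y k - ys‖ ^ 2)
      + δ ^ 2 * β k * ε k / 2 * (‖x k‖ ^ 2 + ‖y k‖ ^ 2)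
      + δ ^ 2 * β k * G k + δ / 2 * ‖lam k - ls‖ ^ 2 := ⟨_, fun _ => rfl⟩
  have hEstep : ∀ k, 1 ≤ k →
      E (k + 1) ≤ E k + δ / 2 * (‖xs‖ ^ 2 + ‖ys‖ ^ 2) * (α k * β k * ε k) := by
    intro k hk
    obtain ⟨u, v, hu, hv, hx1, hy1⟩ := hstep k hk
    rw [hZdw k hk] at hx1
    rw [hHdh k hk] at hy1
    have hβk := hβpos k hk
    have hαk := hα k hk
    have hεk := hεnn k hk
    have bx := block_energy_step hαk hβk hδ hεk hμf hδγ (hZ k hk) (hw k) (hw (k + 1)) hx1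
      (hu (x k)) (hfS _ xs u hu)
    have bdy := block_energy_step hαk hβk hδ hεk hμg hδγ (hH k hk) (hh k) (hh (k + 1)) hy1
      (hv (y k)) (hgS _ ys v hv)
    have hcoup : α k * ⟪(ContinuousLinearMap.adjoint A) (lam (k + 1)), w (k + 1) - xs⟫
        + α k * ⟪(ContinuousLinearMap.adjoint B) (lam (k + 1)), h (k + 1) - ys⟫
        = α k * ⟪lam (k + 1), s (k + 1)⟫
          + δ * (⟪lam (k + 1), s (k + 1)⟫ - ⟪lam (k + 1), s k⟫) := by
      have e := congrArg (fun t => ⟪lam (k + 1), t⟫) (hσ k hk)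
      simp only [inner_add_right, inner_sub_right, real_inner_smul_right] at e
      rw [ContinuousLinearMap.adjoint_inner_left, ContinuousLinearMap.adjoint_inner_left]
      rw [hb] at e
      simp only [map_sub, inner_sub_right, inner_add_right] at e ⊢
      linarith
    have hl : ‖lam (k + 1) - ls‖ ^ 2 / 2 - β k * (α k * ⟪lam (k + 1) - ls, s (k + 1)⟫
        + δ * (⟪lam (k + 1) - ls, s (k + 1)⟫ - ⟪lam (k + 1) - ls, s k⟫))
        ≤ ‖lam k - ls‖ ^ 2 / 2 := by
      have e : lam k - ls = (lam (k + 1) - ls)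
          - β k • (α k • s (k + 1) + δ • (s (k + 1) - s k)) := by
        rw [hlam' k hk]; abel
      rw [e]
      generalize lam (k + 1) - ls = t
      rw [norm_sub_sq_real t]
      have := sq_nonneg ‖β k • (α k • s (k + 1) + δ • (s (k + 1) - s k))‖
      simp only [inner_add_right, inner_sub_right, real_inner_smul_right]
      linarith
    have hβε : δ * (β (k + 1) * ε (k + 1)) ≤ (δ * β k + α k * β k) * ε k := by
      have h1 := mul_le_mul_of_nonneg_left (hεmono k hk)
        (mul_nonneg hδ.le (hβpos (k + 1) (by omega)).le)
      have h2 := mul_le_mul_of_nonneg_right (hββ k hk) hεk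
      linarith
    have t1 := mul_le_mul_of_nonneg_right hβε
      (show 0 ≤ δ / 2 * (‖x (k + 1)‖ ^ 2 + ‖y (k + 1)‖ ^ 2) by positivity)
    have t2 := mul_le_mul_of_nonneg_right (hββ k hk) (mul_nonneg hδ.le (hGnn (k + 1)))
    have t3 := mul_le_mul_of_nonneg_left hl hδ.le
    have t4 := congrArg (fun t => δ * β k * t) hcoup
    simp only [inner_sub_left] at t3
    rw [hE, hE]
    rw [hGe (k + 1)] at t2 ⊢
    rw [hGe k]
    linarith
  obtain ⟨K, hK⟩ := exists_bound_of_le_add_summable (hsum.mul_left _)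
    (fun k hk => mul_nonneg (by positivity)
      (mul_nonneg (mul_nonneg (hα k hk).le (hβpos k hk).le) (hεnn k hk))) hEstep
  have hparts : ∀ k, 1 ≤ k → ‖w k - xs‖ ^ 2 ≤ 2 * K ∧ ‖h k - ys‖ ^ 2 ≤ 2 * K ∧
      δ ^ 2 * β k * G k ≤ K ∧ δ / 2 * ‖lam k - ls‖ ^ 2 ≤ K := by
    intro k hk
    have h0 := hK k hk
    rw [hE] at h0
    have p1 : 0 ≤ ‖w k - xs‖ ^ 2 / 2 := by positivity
    have p2 : 0 ≤ ‖h k - ys‖ ^ 2 / 2 := by positivity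
    have p3 : 0 ≤ (δ * γ - 1) / 2 * (‖x k - xs‖ ^ 2 + ‖y k - ys‖ ^ 2) :=
      mul_nonneg (by linarith) (by positivity)
    have hβk := hβpos k hk
    have hεk := hεnn k hk
    have hGk := hGnn k
    have p4 : 0 ≤ δ ^ 2 * β k * ε k / 2 * (‖x k‖ ^ 2 + ‖y k‖ ^ 2) := by positivity
    have p5 : 0 ≤ δ ^ 2 * β k * G k := by positivity
    have p6 : 0 ≤ δ / 2 * ‖lam k - ls‖ ^ 2 := by positivity
    refine ⟨?_, ?_, ?_, ?_⟩ <;> linarith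
  have hwb : ∀ k, 1 ≤ k → ‖w k‖ ≤ √(2 * K) + ‖xs‖ := fun k hk => by
    have := Real.le_sqrt_of_sq_le (hparts k hk).1
    linarith [norm_le_norm_sub_add (w k) xs]
  have hhb : ∀ k, 1 ≤ k → ‖h k‖ ≤ √(2 * K) + ‖ys‖ := fun k hk => by
    have := Real.le_sqrt_of_sq_le (hparts k hk).2.1
    linarith [norm_le_norm_sub_add (h k) ys]
  have hlb : ∀ k, 1 ≤ k → ‖lam k‖ ≤ √(2 * K / δ) + ‖ls‖ := fun k hk => by
    have h2 : ‖lam k - ls‖ ^ 2 ≤ 2 * K / δ := by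
      rw [le_div_iff₀ hδ]; linarith [(hparts k hk).2.2.2]
    have := Real.le_sqrt_of_sq_le h2
    linarith [norm_le_norm_sub_add (lam k) ls]
  have hcα : ∀ k, 1 ≤ k → 0 ≤ α k / δ := fun k hk => div_nonneg (hα k hk).le hδ.le
  have hxb := norm_le_of_averaging (p := x) (q := w) hcα
    (le_max_left ‖x 1‖ (√(2 * K) + ‖xs‖)) (fun k hk => (hwb k hk).trans (le_max_right _ _))
    (fun k hk => by
      rw [div_eq_inv_mul, mul_smul, hwx k hk, smul_add, smul_smul δ⁻¹ δ,
        inv_mul_cancel₀ hδ.ne']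
      module)
  have hyb := norm_le_of_averaging (p := y) (q := h) hcα
    (le_max_left ‖y 1‖ (√(2 * K) + ‖ys‖)) (fun k hk => (hhb k hk).trans (le_max_right _ _))
    (fun k hk => by
      rw [div_eq_inv_mul, mul_smul, hhy k hk, smul_add, smul_smul δ⁻¹ δ,
        inv_mul_cancel₀ hδ.ne']
      module)
  obtain ⟨N, hN⟩ : ∃ N : ℝ, ∀ k, 1 ≤ k → β k * ‖s k‖ ≤ N := by
    let c : ℕ → ℝ := fun k => (δ * β k + α k * β k - δ * β (k + 1)) / (δ * β (k + 1))
    have hcβ : ∀ k, 1 ≤ k → c k * (δ * β (k + 1)) = δ * β k + α k * β k - δ * β (k + 1) :=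
      fun k hk => div_mul_cancel₀ _ (mul_pos hδ (hβpos (k + 1) (by omega))).ne'
    have hpb := norm_le_of_averaging (p := fun k => lam k - (δ * β k) • s k) (q := lam) (c := c)
      (fun k hk => div_nonneg (by linarith [hββ k hk])
        (mul_pos hδ (hβpos (k + 1) (by omega))).le)
      (le_max_left _ (√(2 * K / δ) + ‖ls‖)) (fun k hk => (hlb k hk).trans (le_max_right _ _))
      (fun k hk => by
        have e : (1 + c k) * (δ * β (k + 1)) = δ * β k + α k * β k := by
          rw [add_mul, hcβ k hk]; ring
        rw [smul_sub, smul_smul, e, add_smul, one_smul]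
        nth_rewrite 1 [hlam' k hk]
        module)
    refine ⟨(max ‖lam 1 - (δ * β 1) • s 1‖ (√(2 * K / δ) + ‖ls‖)
      + (√(2 * K / δ) + ‖ls‖)) / δ, fun k hk => ?_⟩
    · rw [le_div_iff₀ hδ]
      have h1 := norm_sub_le (lam k) (lam k - (δ * β k) • s k)
      rw [sub_sub_cancel, norm_smul, Real.norm_of_nonneg (mul_pos hδ (hβpos k hk)).le] at h1
      have h2 := hpb k hk
      have h3 := hlb k hk
      linarith
  refine ⟨⟨max (max (max ‖x 1‖ (√(2 * K) + ‖xs‖)) (max ‖y 1‖ (√(2 * K) + ‖ys‖)))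
    (√(2 * K / δ) + ‖ls‖), fun k hk => ⟨?_, ?_, ?_⟩⟩,
    |K / δ ^ 2| + (1 + ‖ls‖) * |N| + 1, by positivity, fun k hk => ?_⟩
  · exact (hxb k hk).trans ((le_max_left _ _).trans (le_max_left _ _))
  · exact (hyb k hk).trans ((le_max_right _ _).trans (le_max_left _ _))
  · exact (hlb k hk).trans (le_max_right _ _)
  have hβk := hβpos k hk
  have hGk : β k * G k ≤ |K / δ ^ 2| := by
    refine le_trans ?_ (le_abs_self _)
    rw [le_div_iff₀ (by positivity)]
    linarith [(hparts k hk).2.2.1]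
  have hNk : β k * ‖s k‖ ≤ |N| := (hN k hk).trans (le_abs_self N)
  have hprod : ‖ls‖ * (β k * ‖s k‖) ≤ ‖ls‖ * |N| :=
    mul_le_mul_of_nonneg_left hNk (norm_nonneg _)
  have hn1 := abs_nonneg N
  have hn2 := abs_nonneg (K / δ ^ 2)
  have hn3 := mul_nonneg (norm_nonneg ls) hn1
  rw [← hG, ← hs, le_div_iff₀ hβk, le_div_iff₀ hβk, le_div_iff₀ hβk]
  refine ⟨by linarith, ?_, by linarith⟩
  have e : f (x k) + g (y k) - (f xs + g ys) = G k - ⟪ls, s k⟫ := by rw [hGe]; ring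
  have h1 : |G k - ⟪ls, s k⟫| ≤ G k + ‖ls‖ * ‖s k‖ := by
    refine (abs_sub _ _).trans ?_
    rw [abs_of_nonneg (hGnn k)]
    linarith [abs_real_inner_le_norm ls (s k)]
  rw [e]
  have := mul_le_mul_of_nonneg_right h1 hβk.le
  linarith
end

section
/- Take β_k = k, α_k = 1/k and ε_k = 1/k³, suppose μ_g = 0 (g convex), f ∈ S⁰_{μ_f}(X) with μ_f ≥ 0, 0 < δ ≤ 1 and δγ − 1 ≥ 0, and let (x_k, y_k, λ_k) be generated by the scheme (disc) with the semi-implicit multiplier choice λ̄_{k+1} = λ_k + α_kβ_k(AZ^δ_{k+1} + BH^δ_k − b) and λ̂_{k+1} = λ_{k+1} (Algorithm 2). Let (x*,y*,λ*) be a saddle point of L. Then the sequence (x_k, y_k, λ_k) is bounded and there exists C > 0 such that for all k ≥ 1: L(x_k, y_k, λ*) − L(x*, y*, λ*) ≤ C/k, |Φ(x_k, y_k) − Φ(x*, y*)| ≤ C/k, and ‖Ax_k + By_k − b‖ ≤ C/k. -/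
open Filter Topology
open scoped RealInnerProductSpace

/-- If every `u (k + 1)` is a weighted average of `u k` and a vector of norm at most `M`, then `u`
stays in the ball of radius `M` once it is there. -/
theorem norm_le_of_weighted_average {E : Type*} [NormedAddCommGroup E] [NormedSpace ℝ E]
    {u w : ℕ → E} {a c : ℕ → ℝ} {M : ℝ} {n : ℕ}
    (ha : ∀ k, n ≤ k → 0 ≤ a k) (hc : ∀ k, n ≤ k → 0 ≤ c k) (hac : ∀ k, n ≤ k → 0 < a k + c k)
    (hu : ∀ k, n ≤ k → (a k + c k) • u (k + 1) = a k • u k + c k • w (k + 1))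
    (hw : ∀ k, n ≤ k → ‖w (k + 1)‖ ≤ M) (hn : ‖u n‖ ≤ M) {k : ℕ} (hk : n ≤ k) : ‖u k‖ ≤ M := by
  induction k, hk using Nat.le_induction with
  | base => exact hn
  | succ k hk ih =>
    have h : (a k + c k) * ‖u (k + 1)‖ ≤ (a k + c k) * M := by
      calc (a k + c k) * ‖u (k + 1)‖ = ‖(a k + c k) • u (k + 1)‖ := by
            rw [norm_smul, Real.norm_of_nonneg (hac k hk).le]
        _ ≤ ‖a k • u k‖ + ‖c k • w (k + 1)‖ := by rw [hu k hk]; exact norm_add_le _ _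
        _ = a k * ‖u k‖ + c k * ‖w (k + 1)‖ := by
            rw [norm_smul, norm_smul, Real.norm_of_nonneg (ha k hk), Real.norm_of_nonneg (hc k hk)]
        _ ≤ a k * M + c k * M :=
            add_le_add (mul_le_mul_of_nonneg_left ih (ha k hk))
              (mul_le_mul_of_nonneg_left (hw k hk) (hc k hk))
        _ = (a k + c k) * M := by ring
    exact le_of_mul_le_mul_left h (hac k hk)

/-- Energy estimate for one primal block: `p` is the iterate, `z` its extrapolation, `p'` and `z'`
their updates, `s` a reference point and `w` the multiplier term of the step. -/
theorem block_energy_le {E : Type*} [NormedAddCommGroup E] [InnerProductSpace ℝ E]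
    {h : E → ℝ} {p p' z z' s u w : E} {δ κ c e μ : ℝ}
    (hδ : 0 ≤ δ) (hκ : 0 ≤ κ) (hc : 0 ≤ c) (he : 0 ≤ e) (hμ : 0 ≤ μ)
    (hu : ∀ v, h v - h p' - ⟪u, v - p'⟫ ≥ μ / 2 * ‖v - p'‖ ^ 2)
    (hz' : z' = p' + κ • (p' - p))
    (hstep : z' - z = -(δ • (u + w + e • p' - μ • (p' - z'))) - c • (p' - p)) :
    (‖z' - s‖ ^ 2 - ‖z - s‖ ^ 2) / 2 + c / 2 * (‖p' - s‖ ^ 2 - ‖p - s‖ ^ 2)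
      + δ * ((1 + κ) * h p' - κ * h p - h s) + δ * κ * e / 2 * (‖p'‖ ^ 2 - ‖p‖ ^ 2)
      + δ * ⟪w, z' - s⟫ ≤ δ * e / 2 * ‖s‖ ^ 2 := by
  have hz : ‖z - s‖ ^ 2 = ‖z' - s‖ ^ 2 - 2 * ⟪z' - z, z' - s⟫ + ‖z' - z‖ ^ 2 := by
    rw [show z - s = (z' - s) - (z' - z) by abel, norm_sub_sq_real, real_inner_comm]
  have hinner : ⟪z' - z, z' - s⟫ = -δ * (⟪u, z' - s⟫ + ⟪w, z' - s⟫ + e * ⟪p', z' - s⟫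
      - μ * ⟪p' - z', z' - s⟫) - c * ⟪p' - p, z' - s⟫ := by
    rw [hstep]
    simp only [inner_sub_left, inner_neg_left, inner_add_left, real_inner_smul_left]
    ring
  have hzs : z' - s = (p' - s) + κ • (p' - p) := by rw [hz']; abel
  have hpz : ⟪p' - z', z' - s⟫ =
      (‖p' - s‖ ^ 2 - ‖z' - s‖ ^ 2 - ‖p' - z'‖ ^ 2) / 2 := by
    rw [show p' - s = (p' - z') + (z' - s) by abel, norm_add_sq_real]
    ring
  have hp' : ⟪p', z' - s⟫ = (‖p'‖ ^ 2 + ‖p' - s‖ ^ 2 - ‖s‖ ^ 2) / 2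
      + κ / 2 * (‖p'‖ ^ 2 - ‖p‖ ^ 2 + ‖p' - p‖ ^ 2) := by
    rw [hzs, inner_add_right, real_inner_smul_right, norm_sub_sq_real, norm_sub_sq_real,
      inner_sub_right, inner_sub_right, real_inner_self_eq_norm_sq]
    ring
  have hpp : ⟪p' - p, z' - s⟫ = (‖p' - s‖ ^ 2 - ‖p - s‖ ^ 2) / 2
      + (1 / 2 + κ) * ‖p' - p‖ ^ 2 := by
    rw [hzs, inner_add_right, real_inner_smul_right, real_inner_self_eq_norm_sq,
      show p - s = (p' - s) - (p' - p) by abel, norm_sub_sq_real (p' - s), real_inner_comm]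
    ring
  have hus : ⟪u, z' - s⟫ = -⟪u, s - p'⟫ - κ * ⟪u, p - p'⟫ := by
    rw [hzs]
    simp only [inner_sub_right, inner_add_right, real_inner_smul_right]
    ring
  have hs := hu s
  have hp := hu p
  rw [norm_sub_rev s p'] at hs
  have hlower : (1 + κ) * h p' - κ * h p - h s + μ / 2 * ‖p' - s‖ ^ 2 ≤ ⟪u, z' - s⟫ := by
    have h0 : 0 ≤ μ / 2 * ‖p - p'‖ ^ 2 := by positivity
    have := mul_nonneg hκ (h0.trans hp)
    linarith
  have h1 := mul_le_mul_of_nonneg_left hlower hδ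
  have h2 : 0 ≤ ‖z' - z‖ ^ 2 := by positivity
  have h3 : 0 ≤ δ * μ * (‖z' - s‖ ^ 2 + ‖p' - z'‖ ^ 2) := by positivity
  have h4 : 0 ≤ δ * e * (‖p'‖ ^ 2 + ‖p' - s‖ ^ 2 + κ * ‖p' - p‖ ^ 2) := by positivity
  have h5 : 0 ≤ c * ((1 / 2 + κ) * ‖p' - p‖ ^ 2) := by positivity
  rw [hpz, hp', hpp] at hinner
  linarith

/-- Energy estimate for the multiplier update of the semi-implicit scheme, where `Δ = l' - l` is
the residual `a + q'` and the first block only sees the old value `q` of the second one. -/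
theorem multiplier_energy_le {E : Type*} [NormedAddCommGroup E] [InnerProductSpace ℝ E]
    {l l' s a q q' : E} (hl : l' = l + (a + q')) :
    (‖l' - s‖ ^ 2 - ‖l - s‖ ^ 2) / 2 + (‖q'‖ ^ 2 - ‖q‖ ^ 2) / 2 + ⟪s, a + q'⟫
      ≤ ⟪l + (a + q), a⟫ + ⟪l', q'⟫ := by
  have hsq : 0 ≤ ‖a + q‖ ^ 2 := by positivity
  subst hl
  rw [norm_sub_sq_real, norm_sub_sq_real, norm_add_sq_real l, norm_add_sq_real a]
  rw [norm_add_sq_real] at hsq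
  simp only [inner_add_left, inner_add_right, real_inner_self_eq_norm_sq]
  rw [real_inner_comm a s, real_inner_comm q' s]
  rw [real_inner_comm q a] at hsq
  linarith

theorem half_inv_cube_le_inv_sub_inv_succ {t : ℝ} (ht : 1 ≤ t) :
    1 / t ^ 3 / 2 ≤ 1 / t - 1 / (t + 1) := by
  have h0 : 0 < t := by linarith
  rw [div_sub_div _ _ h0.ne' (by positivity), div_div, div_le_div_iff₀ (by positivity)
    (by positivity)]
  have h1 : t ≤ t ^ 2 := by nlinarith
  have h2 : t ^ 2 ≤ t ^ 3 := by nlinarith [sq_nonneg t]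
  linarith

set_option maxHeartbeats 1000000 in
theorem convergence_rate_convex_case
    {X Y Z : Type*}
    [NormedAddCommGroup X] [InnerProductSpace ℝ X] [CompleteSpace X]
    [NormedAddCommGroup Y] [InnerProductSpace ℝ Y] [CompleteSpace Y]
    [NormedAddCommGroup Z] [InnerProductSpace ℝ Z] [CompleteSpace Z]
    (f : X → ℝ) (g : Y → ℝ)
    (hfconv : ConvexOn ℝ Set.univ f) (hfcont : Continuous f)
    (hgconv : ConvexOn ℝ Set.univ g) (hgcont : Continuous g)
    (A : X →L[ℝ] Z) (B : Y →L[ℝ] Z) (b : Z)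
    (μf μg : ℝ) (hμf : 0 ≤ μf) (hμg : 0 ≤ μg)
    (hfS : ∀ x u v : X, (∀ w, f w - f x ≥ ⟪v, w - x⟫) →
        f u - f x - ⟪v, u - x⟫ ≥ μf / 2 * ‖u - x‖ ^ 2)
    (hgS : ∀ y u v : Y, (∀ w, g w - g y ≥ ⟪v, w - y⟫) →
        g u - g y - ⟪v, u - y⟫ ≥ μg / 2 * ‖u - y‖ ^ 2)
    (L : X → Y → Z → ℝ)
    (hL : ∀ x y l, L x y l = f x + g y + ⟪l, A x + B y - b⟫)
    (δ γ : ℝ) (hδ : 0 < δ) (hγ : 0 < γ) (hδ1 : δ ≤ 1) (hδγ : δ * γ - 1 ≥ 0)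
    (α β ε : ℕ → ℝ)
    (hαdef : ∀ k : ℕ, 1 ≤ k → α k = 1 / (k : ℝ))
    (hβdef : ∀ k : ℕ, 1 ≤ k → β k = (k : ℝ))
    (hεdef : ∀ k : ℕ, 1 ≤ k → ε k = 1 / (k : ℝ) ^ 3)
    (hμg0 : μg = 0)
    (x : ℕ → X) (y : ℕ → Y) (lam : ℕ → Z)
    (Zs Zd : ℕ → X) (Hs Hd : ℕ → Y)
    (hZ : ∀ k, 1 ≤ k → Zs (k + 1) = (1 / α k) • (x (k + 1) - x k) + γ • x (k + 1))
    (hZd : ∀ k, 1 ≤ k → Zd (k + 1) = δ • Zs (k + 1) + (1 - δ * γ) • x (k + 1))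
    (hH : ∀ k, 1 ≤ k → Hs (k + 1) = (1 / α k) • (y (k + 1) - y k) + γ • y (k + 1))
    (hHd : ∀ k, 1 ≤ k → Hd (k + 1) = δ • Hs (k + 1) + (1 - δ * γ) • y (k + 1))
    (hlam : ∀ k, 1 ≤ k → lam (k + 1) = lam k + (α k * β k) • (A (Zd (k + 1)) + B (Hd (k + 1)) - b))
    (hstep : ∀ k, 1 ≤ k → ∃ u v,
        (∀ w, f w - f (x (k + 1)) ≥ ⟪u, w - x (k + 1)⟫) ∧
        (∀ w, g w - g (y (k + 1)) ≥ ⟪v, w - y (k + 1)⟫) ∧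
        (1 / α k) • (Zs (k + 1) - Zs k) =
          -(β k • (u + (ContinuousLinearMap.adjoint A) (lam k + (α k * β k) • (A (Zd (k + 1)) + B (Hd k) - b)) + ε k • x (k + 1)
              - μf • (x (k + 1) - Zd (k + 1)))) ∧
        (1 / α k) • (Hs (k + 1) - Hs k) =
          -(β k • (v + (ContinuousLinearMap.adjoint B) (lam (k + 1)) + ε k • y (k + 1)
              - μg • (y (k + 1) - Hd (k + 1)))))
    (xs : X) (ys : Y) (ls : Z)
    (hsaddle : ∀ x' y' l', L xs ys l' ≤ L xs ys ls ∧ L xs ys ls ≤ L x' y' ls)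
    :
    (∃ M : ℝ, ∀ k, 1 ≤ k → ‖x k‖ ≤ M ∧ ‖y k‖ ≤ M ∧ ‖lam k‖ ≤ M) ∧
    ∃ C : ℝ, 0 < C ∧ ∀ k : ℕ, 1 ≤ k →
      L (x k) (y k) ls - L xs ys ls ≤ C / (k : ℝ) ∧
      |f (x k) + g (y k) - (f xs + g ys)| ≤ C / (k : ℝ) ∧
      ‖A (x k) + B (y k) - b‖ ≤ C / (k : ℝ) := by
  have hfeas : A xs + B ys - b = 0 := by
    have h := (hsaddle xs ys (ls + (A xs + B ys - b))).1
    rw [hL, hL, inner_add_left, real_inner_self_eq_norm_sq] at h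
    have : ‖A xs + B ys - b‖ ^ 2 = 0 := le_antisymm (by linarith) (by positivity)
    simpa using this
  have hLs : L xs ys ls = f xs + g ys := by simp [hL, hfeas]
  set gap : ℕ → ℝ := fun k => L (x k) (y k) ls - L xs ys ls with hgap
  have hgap0 : ∀ k, 0 ≤ gap k := fun k => sub_nonneg.2 (hsaddle (x k) (y k) ls).2
  have hαi : ∀ k : ℕ, 1 ≤ k → 1 / α k = (k : ℝ) := fun k hk => by simp [hαdef k hk]
  have hαβ : ∀ k : ℕ, 1 ≤ k → α k * β k = 1 := fun k hk => by
    have : (k : ℝ) ≠ 0 := by positivity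
    rw [hαdef k hk, hβdef k hk]
    field_simp
  have hZd' : ∀ k, 1 ≤ k → Zd (k + 1) = x (k + 1) + (δ * k) • (x (k + 1) - x k) := fun k hk => by
    rw [hZd k hk, hZ k hk, hαi k hk]
    module
  have hHd' : ∀ k, 1 ≤ k → Hd (k + 1) = y (k + 1) + (δ * k) • (y (k + 1) - y k) := fun k hk => by
    rw [hHd k hk, hH k hk, hαi k hk]
    module
  have hres : ∀ k, A (Zd (k + 1)) + B (Hd (k + 1)) - b
      = A (Zd (k + 1) - xs) + B (Hd (k + 1) - ys) := fun k => by
    rw [sub_eq_zero] at hfeas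
    rw [map_sub, map_sub, ← hfeas]
    abel
  have hmixed : ∀ k, A (Zd (k + 1)) + B (Hd k) - b
      = A (Zd (k + 1) - xs) + B (Hd k - ys) := fun k => by
    rw [sub_eq_zero] at hfeas
    rw [map_sub, map_sub, ← hfeas]
    abel
  have hlam' : ∀ k, 1 ≤ k →
      lam (k + 1) = lam k + (A (Zd (k + 1) - xs) + B (Hd (k + 1) - ys)) := fun k hk => by
    rw [hlam k hk, hαβ k hk, one_smul, hres]
  have hreseq : ∀ k, 1 ≤ k → A (Zd (k + 1) - xs) + B (Hd (k + 1) - ys)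
      = (1 + δ * k) • (A (x (k + 1)) + B (y (k + 1)) - b)
        - (δ * k) • (A (x k) + B (y k) - b) := fun k hk => by
    rw [← hres, hZd' k hk, hHd' k hk]
    simp only [map_add, map_smul, map_sub]
    module
  let E : ℕ → ℝ := fun k =>
    (‖Zd k - xs‖ ^ 2 + ‖Hd k - ys‖ ^ 2) / 2
      + (δ * γ - 1) / 2 * (‖x k - xs‖ ^ 2 + ‖y k - ys‖ ^ 2)
      + δ * ((‖lam k - ls‖ ^ 2 + ‖B (Hd k - ys)‖ ^ 2) / 2)
      + δ * (δ * k * gap k)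
      + δ ^ 2 / 2 * ((1 / (k : ℝ) ^ 2) * (‖x k‖ ^ 2 + ‖y k‖ ^ 2))
      + δ * ((1 / k) * (‖xs‖ ^ 2 + ‖ys‖ ^ 2))
  have hE_step : ∀ k, 2 ≤ k → E (k + 1) ≤ E k := by
    intro k hk
    have hk1 : 1 ≤ k := by omega
    have hkpos : (0 : ℝ) < k := by positivity
    have hkge : (1 : ℝ) ≤ k := by exact_mod_cast hk1
    obtain ⟨u, v, hu, hv, hstepX, hstepY⟩ := hstep k hk1
    rw [hαi k hk1, hαβ k hk1, one_smul, hmixed, hβdef k hk1, ← smul_neg] at hstepX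
    rw [hαi k hk1, hβdef k hk1, ← smul_neg] at hstepY
    have hstepX := smul_right_injective X hkpos.ne' hstepX
    have hstepY := smul_right_injective Y hkpos.ne' hstepY
    obtain ⟨j, rfl⟩ : ∃ j, k = j + 1 := ⟨k - 1, by omega⟩
    have hj : 1 ≤ j := by omega
    have hX : Zd (j + 1 + 1) - Zd (j + 1) = δ • (Zs (j + 1 + 1) - Zs (j + 1))
        - (δ * γ - 1) • (x (j + 1 + 1) - x (j + 1)) := by
      rw [hZd (j + 1) hk1, hZd j hj]
      module
    have hY : Hd (j + 1 + 1) - Hd (j + 1) = δ • (Hs (j + 1 + 1) - Hs (j + 1))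
        - (δ * γ - 1) • (y (j + 1 + 1) - y (j + 1)) := by
      rw [hHd (j + 1) hk1, hHd j hj]
      module
    rw [hstepX, smul_neg] at hX
    rw [hstepY, smul_neg] at hY
    generalize j + 1 = k at *
    have he : 0 ≤ ε k := by rw [hεdef k hk1]; positivity
    have hκ : 0 ≤ δ * k := by positivity
    have bX := block_energy_le (s := xs) hδ.le hκ hδγ he hμf
      (fun w => hfS _ w u hu) (hZd' k hk1) hX
    have bY := block_energy_le (s := ys) hδ.le hκ hδγ he hμg
      (fun w => hgS _ w v hv) (hHd' k hk1) hY
    rw [ContinuousLinearMap.adjoint_inner_left] at bX bY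
    have bM := mul_le_mul_of_nonneg_left
      (multiplier_energy_le (s := ls) (q := B (Hd k - ys)) (hlam' k hk1)) hδ.le
    rw [hreseq k hk1, inner_sub_right, real_inner_smul_right, real_inner_smul_right] at bM
    have hg1 : gap (k + 1) = f (x (k + 1)) + g (y (k + 1))
        + ⟪ls, A (x (k + 1)) + B (y (k + 1)) - b⟫ - (f xs + g ys) := by
      rw [hgap, ← hLs]; simp only [hL]
    have hg0 : gap k = f (x k) + g (y k)
        + ⟪ls, A (x k) + B (y k) - b⟫ - (f xs + g ys) := by
      rw [hgap, ← hLs]; simp only [hL]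
    have hke : (k : ℝ) * ε k = 1 / (k : ℝ) ^ 2 := by
      rw [hεdef k hk1]; field_simp
    have hgapδ : 0 ≤ δ * ((1 - δ) * gap (k + 1)) :=
      mul_nonneg hδ.le (mul_nonneg (by linarith) (hgap0 _))
    have hsq : δ ^ 2 / 2 * (1 / ((k + 1 : ℕ) : ℝ) ^ 2 * (‖x (k + 1)‖ ^ 2 + ‖y (k + 1)‖ ^ 2))
        ≤ δ ^ 2 / 2 * (k * ε k * (‖x (k + 1)‖ ^ 2 + ‖y (k + 1)‖ ^ 2)) := by
      rw [hke]
      push_cast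
      gcongr
      linarith
    have htail : ε k / 2 ≤ 1 / k - 1 / ((k + 1 : ℕ) : ℝ) := by
      rw [hεdef k hk1, Nat.cast_succ]
      exact half_inv_cube_le_inv_sub_inv_succ hkge
    have htail' := mul_le_mul_of_nonneg_left htail
      (show 0 ≤ δ * (‖xs‖ ^ 2 + ‖ys‖ ^ 2) by positivity)
    simp only [E]
    rw [← hke]
    rw [hg1] at hgapδ ⊢
    rw [hg0]
    push_cast at hsq htail' ⊢
    linear_combination bX + bY + bM + hgapδ + hsq + htail'
  have hE_le : ∀ k, 2 ≤ k → E k ≤ E 2 := fun k hk => by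
    induction k, hk using Nat.le_induction with
    | base => exact le_rfl
    | succ k hk ih => exact (hE_step k hk).trans ih
  have hZsq : ∀ k, 2 ≤ k → ‖Zd k - xs‖ ^ 2 ≤ 2 * E 2 ∧ ‖Hd k - ys‖ ^ 2 ≤ 2 * E 2 ∧
      ‖lam k - ls‖ ^ 2 ≤ 2 * E 2 / δ ∧ k * gap k ≤ E 2 / δ ^ 2 := fun k hk => by
    have h := hE_le k hk
    have h1 : 0 ≤ (δ * γ - 1) / 2 * (‖x k - xs‖ ^ 2 + ‖y k - ys‖ ^ 2) :=
      mul_nonneg (by linarith) (by positivity)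
    have h2 : 0 ≤ δ * ‖lam k - ls‖ ^ 2 := by positivity
    have h3 : 0 ≤ δ * ‖B (Hd k - ys)‖ ^ 2 := by positivity
    have h4 : 0 ≤ δ * (δ * k * gap k) :=
      mul_nonneg hδ.le (mul_nonneg (by positivity) (hgap0 k))
    have h5 : 0 ≤ δ ^ 2 / 2 * ((1 / (k : ℝ) ^ 2) * (‖x k‖ ^ 2 + ‖y k‖ ^ 2)) := by positivity
    have h6 : 0 ≤ δ * ((1 / (k : ℝ)) * (‖xs‖ ^ 2 + ‖ys‖ ^ 2)) := by positivity
    have h7 : 0 ≤ ‖Zd k - xs‖ ^ 2 := by positivity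
    have h8 : 0 ≤ ‖Hd k - ys‖ ^ 2 := by positivity
    have hEk : E k = (‖Zd k - xs‖ ^ 2 + ‖Hd k - ys‖ ^ 2) / 2
      + (δ * γ - 1) / 2 * (‖x k - xs‖ ^ 2 + ‖y k - ys‖ ^ 2)
      + δ * ((‖lam k - ls‖ ^ 2 + ‖B (Hd k - ys)‖ ^ 2) / 2)
      + δ * (δ * k * gap k)
      + δ ^ 2 / 2 * ((1 / (k : ℝ) ^ 2) * (‖x k‖ ^ 2 + ‖y k‖ ^ 2))
      + δ * ((1 / k) * (‖xs‖ ^ 2 + ‖ys‖ ^ 2)) := rfl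
    refine ⟨by linarith, by linarith, ?_, ?_⟩
    · rw [le_div_iff₀ hδ]; linarith
    · rw [le_div_iff₀ (by positivity)]; linarith
  set r : ℕ → Z := fun k => A (x k) + B (y k) - b with hr
  let q : ℕ → Z := fun k => lam k - (δ * k) • r k
  obtain ⟨N, hN⟩ : ∃ N : ℝ, ‖x 1‖ ≤ N ∧ ‖y 1‖ ≤ N ∧ ‖lam 1‖ ≤ N ∧ ‖q 1‖ ≤ N ∧
      ∀ k, 2 ≤ k → ‖Zd k‖ ≤ N ∧ ‖Hd k‖ ≤ N ∧ ‖lam k‖ ≤ N := by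
    have hR := Real.sqrt_nonneg (2 * E 2)
    have hRδ := Real.sqrt_nonneg (2 * E 2 / δ)
    have hnn := fun v : X => norm_nonneg v
    have hnnY := fun v : Y => norm_nonneg v
    have hnnZ := fun v : Z => norm_nonneg v
    refine ⟨‖x 1‖ + ‖y 1‖ + ‖lam 1‖ + ‖q 1‖ + ‖xs‖ + ‖ys‖ + ‖ls‖ + √(2 * E 2) + √(2 * E 2 / δ),
      ?_, ?_, ?_, ?_, fun k hk => ?_⟩
    iterate 4
      linarith [hnn (x 1), hnn xs, hnnY (y 1), hnnY ys, hnnZ (lam 1), hnnZ (q 1), hnnZ ls]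
    obtain ⟨h1, h2, h3, -⟩ := hZsq k hk
    have h1 := Real.le_sqrt_of_sq_le h1
    have h2 := Real.le_sqrt_of_sq_le h2
    have h3 := Real.le_sqrt_of_sq_le h3
    have t1 := norm_le_norm_add_norm_sub' (Zd k) xs
    have t2 := norm_le_norm_add_norm_sub' (Hd k) ys
    have t3 := norm_le_norm_add_norm_sub' (lam k) ls
    refine ⟨?_, ?_, ?_⟩ <;>
    linarith [hnn (x 1), hnn xs, hnnY (y 1), hnnY ys, hnnZ (lam 1), hnnZ (q 1), hnnZ ls]
  obtain ⟨hx1, hy1, hlam1, hq1, hN⟩ := hN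
  have hxN : ∀ k, 1 ≤ k → ‖x k‖ ≤ N := fun k hk =>
    norm_le_of_weighted_average (w := Zd) (a := fun k => δ * k) (c := fun _ => 1)
      (fun _ _ => by positivity) (fun _ _ => zero_le_one) (fun _ _ => by positivity)
      (fun k hk => by rw [hZd' k hk]; module) (fun k hk => (hN (k + 1) (by omega)).1) hx1 hk
  have hyN : ∀ k, 1 ≤ k → ‖y k‖ ≤ N := fun k hk =>
    norm_le_of_weighted_average (w := Hd) (a := fun k => δ * k) (c := fun _ => 1)
      (fun _ _ => by positivity) (fun _ _ => zero_le_one) (fun _ _ => by positivity)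
      (fun k hk => by rw [hHd' k hk]; module) (fun k hk => (hN (k + 1) (by omega)).2.1) hy1 hk
  have hqN : ∀ k, 1 ≤ k → ‖q k‖ ≤ N := fun k hk =>
    norm_le_of_weighted_average (w := lam) (a := fun k => δ * (k + 1)) (c := fun _ => 1 - δ)
      (fun _ _ => by positivity) (fun _ _ => by linarith)
      (fun k _ => by nlinarith [mul_nonneg hδ.le k.cast_nonneg])
      (fun k hk => by
        have h : lam (k + 1) = lam k + ((1 + δ * k) • r (k + 1) - (δ * k) • r k) := by
          rw [hlam' k hk, hreseq k hk]
        simp only [q]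
        rw [h]
        push_cast
        module)
      (fun k hk => (hN (k + 1) (by omega)).2.2) hq1 hk
  have hlamN : ∀ k, 1 ≤ k → ‖lam k‖ ≤ N := fun k hk => by
    rcases hk.eq_or_lt with rfl | hk
    · exact hlam1
    · exact (hN k hk).2.2
  refine ⟨⟨N, fun k hk => ⟨hxN k hk, hyN k hk, hlamN k hk⟩⟩, ?_⟩
  have hN0 : 0 ≤ N := (norm_nonneg _).trans hx1
  have hE2 : 0 ≤ E 2 := by
    have := (sq_nonneg ‖Zd 2 - xs‖).trans (hZsq 2 le_rfl).1
    linarith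
  have hrk : ∀ k, 1 ≤ k → ‖r k‖ ≤ 2 * N / δ / k := fun k hk => by
    have hkpos : (0 : ℝ) < k := by positivity
    rw [div_div, le_div_iff₀ (by positivity)]
    have h : (δ * k) • r k = lam k - q k := by simp [q]
    have h' := norm_sub_le (lam k) (q k)
    rw [← h, norm_smul, Real.norm_of_nonneg (by positivity)] at h'
    linarith [hlamN k hk, hqN k hk]
  have hgapk : ∀ k, 1 ≤ k → gap k ≤ (E 2 / δ ^ 2 + gap 1) / k := fun k hk => by
    have hkpos : (0 : ℝ) < k := by positivity
    rw [le_div_iff₀ hkpos]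
    rcases hk.eq_or_lt with rfl | hk
    · have : 0 ≤ E 2 / δ ^ 2 := by positivity
      simpa using this
    · linarith [(hZsq k hk).2.2.2, hgap0 1]
  have hG : 0 ≤ E 2 / δ ^ 2 + gap 1 := add_nonneg (by positivity) (hgap0 1)
  have hD : 0 ≤ 2 * N / δ := by positivity
  have hlsD : 0 ≤ ‖ls‖ * (2 * N / δ) := by positivity
  refine ⟨E 2 / δ ^ 2 + gap 1 + ‖ls‖ * (2 * N / δ) + 2 * N / δ + 1, by linarith, fun k hk => ?_⟩
  have hkpos : (0 : ℝ) < k := by positivity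
  have hobj : f (x k) + g (y k) - (f xs + g ys) = gap k - ⟪ls, r k⟫ := by
    simp only [hgap, hLs, hL, hr]; ring
  refine ⟨(hgapk k hk).trans ?_, ?_, (hrk k hk).trans ?_⟩
  · exact div_le_div_of_nonneg_right (by linarith) hkpos.le
  · calc |f (x k) + g (y k) - (f xs + g ys)| ≤ gap k + ‖ls‖ * ‖r k‖ := by
          rw [hobj]
          refine (abs_sub _ _).trans (add_le_add ?_ (abs_real_inner_le_norm _ _))
          rw [abs_of_nonneg (hgap0 k)]
      _ ≤ (E 2 / δ ^ 2 + gap 1) / k + ‖ls‖ * (2 * N / δ / k) := by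
          gcongr
          · exact hgapk k hk
          · exact hrk k hk
      _ = (E 2 / δ ^ 2 + gap 1 + ‖ls‖ * (2 * N / δ)) / k := by ring
      _ ≤ _ := div_le_div_of_nonneg_right (by linarith) hkpos.le
  · exact div_le_div_of_nonneg_right (by linarith) hkpos.le
end

section
/- Let B ≠ 0 and take β_k = μ_g k²/(3‖B‖²), α_k = 1/k and ε_k = 1/(α_kβ_k k³), suppose g ∈ S⁰_{μ_g}(Y) with μ_g > 0, f ∈ S⁰_{μ_f}(X) with μ_f ≥ 0, 0 < δ ≤ 1/3 and δγ − 1 ≥ 0, and let (x_k, y_k, λ_k) be generated by the scheme (disc) with the semi-implicit multiplier choice λ̄_{k+1} = λ_k + α_kβ_k(AZ^δ_{k+1} + BH^δ_k − b) and λ̂_{k+1} = λ_{k+1} (Algorithm 2). Let (x*,y*,λ*) be a saddle point of L. Then the sequence (x_k, y_k, λ_k) is bounded and there exists C > 0 such that for all k ≥ 1: L(x_k, y_k, λ*) − L(x*, y*, λ*) ≤ C/k², |Φ(x_k, y_k) − Φ(x*, y*)| ≤ C/k², and ‖Ax_k + By_k − b‖ ≤ C/k². -/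
open Filter Topology
open scoped RealInnerProductSpace

/-- Sequences obtained by averaging with vectors of a ball stay in that ball. -/
lemma norm_le_of_averaging_s8 {E : Type*} [NormedAddCommGroup E] [NormedSpace ℝ E]
    {a b : ℕ → ℝ} {v z : ℕ → E} {M : ℝ} {m : ℕ}
    (ha : ∀ k, m ≤ k → 0 ≤ a k) (hb : ∀ k, m ≤ k → 0 ≤ b k) (hab : ∀ k, m ≤ k → 0 < a k + b k)
    (hv : ∀ k, m ≤ k → (a k + b k) • v (k + 1) = a k • v k + b k • z k)
    (hz : ∀ k, m ≤ k → ‖z k‖ ≤ M) (hm : ‖v m‖ ≤ M) :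
    ∀ k, m ≤ k → ‖v k‖ ≤ M := by
  intro k hk
  induction k, hk using Nat.le_induction with
  | base => exact hm
  | succ k hk ih =>
    have h1 : (a k + b k) * ‖v (k + 1)‖ ≤ (a k + b k) * M := by
      calc (a k + b k) * ‖v (k + 1)‖ = ‖(a k + b k) • v (k + 1)‖ := by
            rw [norm_smul, Real.norm_of_nonneg (hab k hk).le]
        _ = ‖a k • v k + b k • z k‖ := by rw [hv k hk]
        _ ≤ ‖a k • v k‖ + ‖b k • z k‖ := norm_add_le _ _
        _ = a k * ‖v k‖ + b k * ‖z k‖ := by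
            rw [norm_smul, norm_smul, Real.norm_of_nonneg (ha k hk),
              Real.norm_of_nonneg (hb k hk)]
        _ ≤ a k * M + b k * M :=
            add_le_add (mul_le_mul_of_nonneg_left ih (ha k hk))
              (mul_le_mul_of_nonneg_left (hz k hk) (hb k hk))
        _ = (a k + b k) * M := by ring
    exact le_of_mul_le_mul_left h1 (hab k hk)

lemma half_norm_sub_le_inner {E : Type*} [NormedAddCommGroup E] [InnerProductSpace ℝ E]
    (p q : E) : ‖p‖ ^ 2 / 2 - ‖q‖ ^ 2 / 2 ≤ ⟪p, p - q⟫ := by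
  have := norm_sub_sq_real p q
  rw [inner_sub_right, real_inner_self_eq_norm_sq]
  nlinarith [sq_nonneg ‖p - q‖]

/-- Decrease of the primal part of the energy along one block of the scheme. -/
lemma primal_block_estimate {E : Type*} [NormedAddCommGroup E] [InnerProductSpace ℝ E]
    {x x' xs z z' u w : E} {δ t s e μ κ F F' Fs : ℝ}
    (hδ : 0 ≤ δ) (ht : 0 ≤ t) (hs : 0 ≤ s) (he : 0 ≤ e) (hμ : 0 ≤ μ) (hκ : 0 ≤ κ)
    (hz : z' = x' + (δ * t) • (x' - x))
    (hstep : z' - z = -((δ * s) • (u + w + e • x' + μ • (z' - x'))) - κ • (x' - x))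
    (hFs : Fs - F' - ⟪u, xs - x'⟫ ≥ μ / 2 * ‖xs - x'‖ ^ 2)
    (hF : F - F' - ⟪u, x - x'⟫ ≥ μ / 2 * ‖x - x'‖ ^ 2) :
    (1 + δ * s * μ) / 2 * ‖z' - xs‖ ^ 2 + κ / 2 * ‖x' - xs‖ ^ 2
        + δ * s * ((1 + δ * t) * (F' - Fs)) + δ * s * e / 2 * ((1 + δ * t) * ‖x'‖ ^ 2)
        + δ * s * ⟪w, z' - xs⟫
      ≤ 1 / 2 * ‖z - xs‖ ^ 2 + κ / 2 * ‖x - xs‖ ^ 2 + δ * s * (δ * t * (F - Fs))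
        + δ * s * e / 2 * (δ * t * ‖x‖ ^ 2 + ‖xs‖ ^ 2) := by
  have hsplit : ∀ q : E, ⟪q, z' - xs⟫ = ⟪q, x' - xs⟫ + δ * t * ⟪q, x' - x⟫ := by
    intro q
    rw [show z' - xs = (x' - xs) + (δ * t) • (x' - x) by rw [hz]; abel,
      inner_add_right, real_inner_smul_right]
  have hz2 : ‖z - xs‖ ^ 2 = ‖z' - xs‖ ^ 2 - 2 * ⟪z' - z, z' - xs⟫ + ‖z' - z‖ ^ 2 := by
    rw [show z - xs = (z' - xs) - (z' - z) by abel, norm_sub_sq_real,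
      real_inner_comm (z' - xs) (z' - z)]
  have hin : ⟪z' - z, z' - xs⟫ = -(δ * s * (⟪u, z' - xs⟫ + ⟪w, z' - xs⟫ + e * ⟪x', z' - xs⟫
      + μ * ⟪z' - x', z' - xs⟫)) - κ * ⟪x' - x, z' - xs⟫ := by
    rw [hstep]
    simp only [inner_sub_left, inner_neg_left, inner_add_left, real_inner_smul_left]
  have hu : ⟪u, z' - xs⟫ ≥ (F' - Fs + μ / 2 * ‖x' - xs‖ ^ 2) + δ * t * (F' - F) := by
    rw [hsplit]
    have h1 : ⟪u, x' - xs⟫ = -⟪u, xs - x'⟫ := by rw [← inner_neg_right, neg_sub]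
    have h2 : ⟪u, x' - x⟫ = -⟪u, x - x'⟫ := by rw [← inner_neg_right, neg_sub]
    have h3 : F' - F ≤ ⟪u, x' - x⟫ := by
      have : 0 ≤ μ / 2 * ‖x - x'‖ ^ 2 := by positivity
      linarith
    have h4 := mul_le_mul_of_nonneg_left h3 (mul_nonneg hδ ht)
    rw [norm_sub_rev] at hFs
    linarith
  have hx : ⟪x', z' - xs⟫ ≥ ‖x'‖ ^ 2 / 2 - ‖xs‖ ^ 2 / 2
      + δ * t * (‖x'‖ ^ 2 / 2 - ‖x‖ ^ 2 / 2) := by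
    rw [hsplit]
    have := mul_le_mul_of_nonneg_left (half_norm_sub_le_inner x' x) (mul_nonneg hδ ht)
    linarith [half_norm_sub_le_inner x' xs]
  have hzz : ⟪z' - x', z' - xs⟫ ≥ ‖z' - xs‖ ^ 2 / 2 - ‖x' - xs‖ ^ 2 / 2 := by
    have := half_norm_sub_le_inner (z' - xs) (x' - xs)
    rw [sub_sub_sub_cancel_right, real_inner_comm] at this
    linarith
  have hd : ⟪x' - x, z' - xs⟫ ≥ ‖x' - xs‖ ^ 2 / 2 - ‖x - xs‖ ^ 2 / 2 := by
    rw [hsplit]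
    have := half_norm_sub_le_inner (x' - xs) (x - xs)
    rw [sub_sub_sub_cancel_right, real_inner_comm] at this
    have h2 : 0 ≤ δ * t * ⟪x' - x, x' - x⟫ :=
      mul_nonneg (mul_nonneg hδ ht) real_inner_self_nonneg
    linarith
  have hδs := mul_nonneg hδ hs
  have k1 := mul_le_mul_of_nonneg_left hu hδs
  have k2 := mul_le_mul_of_nonneg_left hx (mul_nonneg hδs he)
  have k3 := mul_le_mul_of_nonneg_left hzz (mul_nonneg hδs hμ)
  have k4 := mul_le_mul_of_nonneg_left hd hκ
  rw [hz2, hin]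
  nlinarith [sq_nonneg ‖z' - z‖]

/-- Decrease of the dual part of the energy for the semi-implicit multiplier. -/
lemma dual_coupling_estimate {E : Type*} [NormedAddCommGroup E] [InnerProductSpace ℝ E]
    {l l' ls p q q' : E} {s : ℝ} (hl : l' = l + s • (p + q')) :
    1 / 2 * ‖l' - ls‖ ^ 2 + s ^ 2 / 2 * ‖q'‖ ^ 2
      ≤ 1 / 2 * ‖l - ls‖ ^ 2 + s ^ 2 / 2 * ‖q‖ ^ 2
        + s * (⟪l + s • (p + q) - ls, p⟫ + ⟪l' - ls, q'⟫) := by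
  have e1 : l' - ls = (l - ls) + s • (p + q') := by rw [hl]; abel
  have e2 : l + s • (p + q) - ls = (l - ls) + s • (p + q) := by abel
  rw [e1, e2]
  generalize l - ls = m
  have h : 0 ≤ s ^ 2 * ‖p + q‖ ^ 2 := by positivity
  simp only [← real_inner_self_eq_norm_sq, inner_add_left, inner_add_right,
    real_inner_smul_left, real_inner_smul_right] at h ⊢
  rw [real_inner_comm m p, real_inner_comm m q', real_inner_comm p q',
    real_inner_comm p q] at *
  nlinarith

/-- One step of the energy, with the step index `t` treated as a real parameter. -/
lemma energy_step {X Y Z : Type*}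
    [NormedAddCommGroup X] [InnerProductSpace ℝ X] [CompleteSpace X]
    [NormedAddCommGroup Y] [InnerProductSpace ℝ Y] [CompleteSpace Y]
    [NormedAddCommGroup Z] [InnerProductSpace ℝ Z] [CompleteSpace Z]
    {A : X →L[ℝ] Z} {B : Y →L[ℝ] Z} {b : Z}
    {x x' xs z z' u : X} {y y' ys h h' v : Y} {l l' ls : Z}
    {δ t c e μf μg κ F F' Fs G G' Gs : ℝ}
    (hδ : 0 < δ) (hδ13 : δ ≤ 1 / 3) (ht : 1 ≤ t) (hc : 0 < c) (hμf : 0 ≤ μf) (hμg : 0 ≤ μg)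
    (hκ : 0 ≤ κ) (hce : c * t * e = 1 / t ^ 3) (hcB : c * ‖B‖ ^ 2 = μg / 3)
    (hfeas : A xs + B ys = b)
    (hz : z' = x' + (δ * t) • (x' - x)) (hh : h' = y' + (δ * t) • (y' - y))
    (hl : l' = l + (c * t) • (A z' + B h' - b))
    (hstepx : z' - z = -((δ * (c * t)) • (u
      + ContinuousLinearMap.adjoint A (l + (c * t) • (A z' + B h - b)) + e • x'
      + μf • (z' - x'))) - κ • (x' - x))
    (hstepy : h' - h = -((δ * (c * t)) • (v + ContinuousLinearMap.adjoint B l' + e • y'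
      + μg • (h' - y'))) - κ • (y' - y))
    (hFs : Fs - F' - ⟪u, xs - x'⟫ ≥ μf / 2 * ‖xs - x'‖ ^ 2)
    (hF : F - F' - ⟪u, x - x'⟫ ≥ μf / 2 * ‖x - x'‖ ^ 2)
    (hGs : Gs - G' - ⟪v, ys - y'⟫ ≥ μg / 2 * ‖ys - y'‖ ^ 2)
    (hG : G - G' - ⟪v, y - y'⟫ ≥ μg / 2 * ‖y - y'‖ ^ 2)
    (hgap : 0 ≤ F' + G' - (Fs + Gs) + ⟪ls, A x' + B y' - b⟫) :
    1 / 2 * ‖z' - xs‖ ^ 2 + 1 / 2 * ‖h' - ys‖ ^ 2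
        + κ / 2 * (‖x' - xs‖ ^ 2 + ‖y' - ys‖ ^ 2)
        + δ ^ 2 * c * (t + 1) ^ 2 * (F' + G' - (Fs + Gs) + ⟪ls, A x' + B y' - b⟫)
        + δ ^ 2 / (2 * (t + 1) ^ 2) * (‖x'‖ ^ 2 + ‖y'‖ ^ 2)
        + δ / 2 * ‖l' - ls‖ ^ 2 + δ * (c * (t + 1)) ^ 2 / 2 * ‖B (h' - ys)‖ ^ 2
      ≤ 1 / 2 * ‖z - xs‖ ^ 2 + 1 / 2 * ‖h - ys‖ ^ 2
        + κ / 2 * (‖x - xs‖ ^ 2 + ‖y - ys‖ ^ 2)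
        + δ ^ 2 * c * t ^ 2 * (F + G - (Fs + Gs) + ⟪ls, A x + B y - b⟫)
        + δ ^ 2 / (2 * t ^ 2) * (‖x‖ ^ 2 + ‖y‖ ^ 2)
        + δ / 2 * ‖l - ls‖ ^ 2 + δ * (c * t) ^ 2 / 2 * ‖B (h - ys)‖ ^ 2
        + δ / 2 * (‖xs‖ ^ 2 + ‖ys‖ ^ 2) / t ^ 3 := by
  have ht0 : 0 < t := by linarith
  have hs : 0 < c * t := by positivity
  have he : 0 ≤ e := by
    have : 0 < c * t * e := by rw [hce]; positivity
    exact (pos_of_mul_pos_right this hs.le).le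
  have bx := primal_block_estimate hδ.le ht0.le hs.le he hμf hκ hz hstepx hFs hF
  have bz := primal_block_estimate hδ.le ht0.le hs.le he hμg hκ hh hstepy hGs hG
  rw [ContinuousLinearMap.adjoint_inner_left] at bx bz
  have hres : A z' + B h' - b = A (z' - xs) + B (h' - ys) := by
    rw [← hfeas, map_sub, map_sub]; abel
  have hres' : A z' + B h - b = A (z' - xs) + B (h - ys) := by
    rw [← hfeas, map_sub, map_sub]; abel
  rw [hres'] at bx
  rw [hres] at hl
  have hd := dual_coupling_estimate (ls := ls) (q := B (h - ys)) hl
  have hsplit : A (z' - xs) + B (h' - ys)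
      = (1 + δ * t) • (A x' + B y' - b) - (δ * t) • (A x + B y - b) := by
    rw [hz, hh, ← hfeas]
    simp only [map_sub, map_add, map_smul]
    module
  have hls : ⟪ls, A (z' - xs)⟫ + ⟪ls, B (h' - ys)⟫
      = (1 + δ * t) * ⟪ls, A x' + B y' - b⟫ - δ * t * ⟪ls, A x + B y - b⟫ := by
    rw [← inner_add_right, hsplit, inner_sub_right, real_inner_smul_right,
      real_inner_smul_right]
  rw [inner_sub_left, inner_sub_left] at hd
  have hBn : ‖B (h' - ys)‖ ^ 2 ≤ ‖B‖ ^ 2 * ‖h' - ys‖ ^ 2 := by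
    rw [← mul_pow]
    exact pow_le_pow_left₀ (norm_nonneg _) (B.le_opNorm _) 2
  have hB : δ * (c * (t + 1)) ^ 2 / 2 * ‖B (h' - ys)‖ ^ 2
      ≤ δ * (c * t) ^ 2 / 2 * ‖B (h' - ys)‖ ^ 2 + δ * (c * t) * μg / 2 * ‖h' - ys‖ ^ 2 := by
    have h1 : c * ‖B (h' - ys)‖ ^ 2 ≤ μg / 3 * ‖h' - ys‖ ^ 2 := by
      have := mul_le_mul_of_nonneg_left hBn hc.le
      rwa [← mul_assoc, hcB] at this
    have h2 := mul_le_mul_of_nonneg_left h1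
      (show 0 ≤ δ * c * (2 * t + 1) / 2 by positivity)
    have h3 : δ * c * (2 * t + 1) / 2 * (μg / 3 * ‖h' - ys‖ ^ 2)
        ≤ δ * c * (3 * t) / 2 * (μg / 3 * ‖h' - ys‖ ^ 2) := by
      gcongr
      linarith
    linarith
  have hcoef : δ ^ 2 * c * (t + 1) ^ 2 ≤ δ * (c * t) * (1 + δ * t) := by
    have : δ * (2 * t + 1) ≤ t := by
      have := mul_le_mul_of_nonneg_right hδ13 (show 0 ≤ 2 * t + 1 by positivity)
      linarith
    have := mul_le_mul_of_nonneg_left this (mul_pos hδ hc).le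
    linarith
  have hg := mul_le_mul_of_nonneg_right hcoef hgap
  have hεcoef : δ ^ 2 / (2 * (t + 1) ^ 2) ≤ δ * (c * t) * e / 2 * (1 + δ * t) := by
    rw [mul_assoc δ, hce]
    calc δ ^ 2 / (2 * (t + 1) ^ 2) ≤ δ ^ 2 / (2 * t ^ 2) := by gcongr; linarith
      _ = δ * (1 / t ^ 3) / 2 * (δ * t) := by field_simp
      _ ≤ δ * (1 / t ^ 3) / 2 * (1 + δ * t) := by gcongr; linarith
  have hε := mul_le_mul_of_nonneg_right hεcoef (show 0 ≤ ‖x'‖ ^ 2 + ‖y'‖ ^ 2 by positivity)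
  have hε' : δ ^ 2 / (2 * t ^ 2) = δ * (c * t) * e / 2 * (δ * t) := by
    rw [mul_assoc δ, hce]; field_simp
  have hε'' : δ / 2 * (‖xs‖ ^ 2 + ‖ys‖ ^ 2) / t ^ 3
      = δ * (c * t) * e / 2 * (‖xs‖ ^ 2 + ‖ys‖ ^ 2) := by
    rw [mul_assoc δ, hce]; field_simp
  rw [hε', hε'']
  have hd' := mul_le_mul_of_nonneg_left hd hδ.le
  have hls' := congrArg (fun r => δ * (c * t) * r) hls
  have hz0 : 0 ≤ δ * (c * t) * μf * ‖z' - xs‖ ^ 2 := by positivity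
  clear * - bx bz hd' hls' hB hg hε hz0
  linarith

/-- Cubically small increments keep a sequence bounded. -/
lemma exists_bound_of_le_add_div_cube {E : ℕ → ℝ} {D : ℝ} (hD : 0 ≤ D)
    (h : ∀ k : ℕ, 2 ≤ k → E (k + 1) ≤ E k + D / (k : ℝ) ^ 3) :
    ∀ k : ℕ, 2 ≤ k → E k ≤ E 2 + D := by
  have key : ∀ k : ℕ, 2 ≤ k → E k + D / ((k : ℝ) - 1) ≤ E 2 + D := by
    intro k hk
    induction k, hk using Nat.le_induction with
    | base => norm_num
    | succ k hk ih =>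
      have hk' : (2 : ℝ) ≤ k := by exact_mod_cast hk
      have h1 : 1 / (k : ℝ) ^ 3 + 1 / k ≤ 1 / ((k : ℝ) - 1) := by
        have h0 : (0 : ℝ) < k - 1 := by linarith
        rw [div_add_div _ _ (by positivity) (by positivity), div_le_div_iff₀ (by positivity) h0]
        nlinarith [pow_pos (show (0 : ℝ) < k by linarith) 3]
      have h2 := mul_le_mul_of_nonneg_left h1 hD
      rw [mul_add, mul_one_div, mul_one_div, mul_one_div] at h2
      push_cast
      rw [add_sub_cancel_right]
      linarith [h k hk]
  intro k hk
  have hk' : (2 : ℝ) ≤ k := by exact_mod_cast hk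
  have : 0 ≤ D / ((k : ℝ) - 1) := div_nonneg hD (by linarith)
  linarith [key k hk]

/-- The Lagrange multiplier increments control the feasibility violation. -/
lemma feasibility_bound {E : Type*} [NormedAddCommGroup E] [NormedSpace ℝ E]
    {r l : ℕ → E} {δ c M : ℝ} (hδ : 0 < δ) (hδ13 : δ ≤ 1 / 3) (hc : 0 < c)
    (hl : ∀ k : ℕ, 2 ≤ k → l (k + 1) = l k + (c * k) • (r (k + 1) + (δ * k) • (r (k + 1) - r k)))
    (hM : ∀ k : ℕ, 2 ≤ k → ‖l k‖ ≤ M) :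
    ∃ R : ℝ, ∀ k : ℕ, 2 ≤ k → (k : ℝ) ^ 2 * ‖r k‖ ≤ R := by
  set w : ℕ → E := fun k => (c * δ * (k : ℝ) ^ 2) • r k - l k with hw
  set M' := max M ‖w 2‖
  have hbd : ∀ k, 2 ≤ k → ‖w k‖ ≤ M' := by
    refine norm_le_of_averaging_s8 (a := fun k => c * δ * ((k : ℝ) + 1) ^ 2)
      (b := fun k => c * (k - δ * (2 * k + 1))) (z := fun k => - l (k + 1))
      ?_ ?_ ?_ ?_ ?_ (le_max_right _ _)
    · intro k _; positivity
    · intro k hk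
      have hk' : (2 : ℝ) ≤ k := by exact_mod_cast hk
      apply mul_nonneg hc.le
      nlinarith
    · intro k hk
      have hk' : (2 : ℝ) ≤ k := by exact_mod_cast hk
      have : c * δ * ((k : ℝ) + 1) ^ 2 + c * (k - δ * (2 * k + 1)) = c * (δ * k ^ 2 + k) := by
        ring
      rw [this]; positivity
    · intro k hk
      simp only [hw, hl k hk]
      push_cast
      module
    · intro k hk
      rw [norm_neg]
      exact (hM (k + 1) (by omega)).trans (le_max_left _ _)
  refine ⟨(M' + M) / (c * δ), fun k hk => ?_⟩
  rw [le_div_iff₀ (by positivity)]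
  have h1 : (c * δ * (k : ℝ) ^ 2) • r k = w k + l k := by simp [hw]
  have h2 : ‖(c * δ * (k : ℝ) ^ 2) • r k‖ = c * δ * (k : ℝ) ^ 2 * ‖r k‖ := by
    rw [norm_smul, Real.norm_of_nonneg (by positivity)]
  rw [h1] at h2
  have := norm_add_le (w k) (l k)
  linarith [hbd k hk, hM k hk]

lemma exists_bound_of_exists_tail_bound {a : ℕ → ℝ} (h : ∃ M, ∀ k, 2 ≤ k → a k ≤ M) :
    ∃ M, ∀ k, 1 ≤ k → a k ≤ M := by
  obtain ⟨M, hM⟩ := h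
  refine ⟨max M (a 1), fun k hk => ?_⟩
  rcases hk.eq_or_lt with rfl | hk
  · exact le_max_right _ _
  · exact (hM k hk).trans (le_max_left _ _)

theorem convergence_rate_partially_strongly_convex_case
    {X Y Z : Type*}
    [NormedAddCommGroup X] [InnerProductSpace ℝ X] [CompleteSpace X]
    [NormedAddCommGroup Y] [InnerProductSpace ℝ Y] [CompleteSpace Y]
    [NormedAddCommGroup Z] [InnerProductSpace ℝ Z] [CompleteSpace Z]
    (f : X → ℝ) (g : Y → ℝ)
    (hfconv : ConvexOn ℝ Set.univ f) (hfcont : Continuous f)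
    (hgconv : ConvexOn ℝ Set.univ g) (hgcont : Continuous g)
    (A : X →L[ℝ] Z) (B : Y →L[ℝ] Z) (b : Z)
    (μf μg : ℝ) (hμf : 0 ≤ μf) (hμg : 0 ≤ μg)
    (hfS : ∀ x u v : X, (∀ w, f w - f x ≥ ⟪v, w - x⟫) →
        f u - f x - ⟪v, u - x⟫ ≥ μf / 2 * ‖u - x‖ ^ 2)
    (hgS : ∀ y u v : Y, (∀ w, g w - g y ≥ ⟪v, w - y⟫) →
        g u - g y - ⟪v, u - y⟫ ≥ μg / 2 * ‖u - y‖ ^ 2)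
    (L : X → Y → Z → ℝ)
    (hL : ∀ x y l, L x y l = f x + g y + ⟪l, A x + B y - b⟫)
    (hB0 : B ≠ 0)
    (δ γ : ℝ) (hδ : 0 < δ) (hγ : 0 < γ) (hδ13 : δ ≤ 1 / 3) (hδγ : δ * γ - 1 ≥ 0)
    (α β ε : ℕ → ℝ)
    (hαdef : ∀ k : ℕ, 1 ≤ k → α k = 1 / (k : ℝ))
    (hβdef : ∀ k : ℕ, 1 ≤ k → β k = μg * (k : ℝ) ^ 2 / (3 * ‖B‖ ^ 2))
    (hεdef : ∀ k : ℕ, 1 ≤ k → ε k = 1 / (α k * β k * (k : ℝ) ^ 3))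
    (hμgpos : 0 < μg)
    (x : ℕ → X) (y : ℕ → Y) (lam : ℕ → Z)
    (Zs Zd : ℕ → X) (Hs Hd : ℕ → Y)
    (hZ : ∀ k, 1 ≤ k → Zs (k + 1) = (1 / α k) • (x (k + 1) - x k) + γ • x (k + 1))
    (hZd : ∀ k, 1 ≤ k → Zd (k + 1) = δ • Zs (k + 1) + (1 - δ * γ) • x (k + 1))
    (hH : ∀ k, 1 ≤ k → Hs (k + 1) = (1 / α k) • (y (k + 1) - y k) + γ • y (k + 1))
    (hHd : ∀ k, 1 ≤ k → Hd (k + 1) = δ • Hs (k + 1) + (1 - δ * γ) • y (k + 1))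
    (hlam : ∀ k, 1 ≤ k → lam (k + 1) = lam k + (α k * β k) • (A (Zd (k + 1)) + B (Hd (k + 1)) - b))
    (hstep : ∀ k, 1 ≤ k → ∃ u v,
        (∀ w, f w - f (x (k + 1)) ≥ ⟪u, w - x (k + 1)⟫) ∧
        (∀ w, g w - g (y (k + 1)) ≥ ⟪v, w - y (k + 1)⟫) ∧
        (1 / α k) • (Zs (k + 1) - Zs k) =
          -(β k • (u + (ContinuousLinearMap.adjoint A) (lam k + (α k * β k) • (A (Zd (k + 1)) + B (Hd k) - b)) + ε k • x (k + 1)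
              - μf • (x (k + 1) - Zd (k + 1)))) ∧
        (1 / α k) • (Hs (k + 1) - Hs k) =
          -(β k • (v + (ContinuousLinearMap.adjoint B) (lam (k + 1)) + ε k • y (k + 1)
              - μg • (y (k + 1) - Hd (k + 1)))))
    (xs : X) (ys : Y) (ls : Z)
    (hsaddle : ∀ x' y' l', L xs ys l' ≤ L xs ys ls ∧ L xs ys ls ≤ L x' y' ls)
    :
    (∃ M : ℝ, ∀ k, 1 ≤ k → ‖x k‖ ≤ M ∧ ‖y k‖ ≤ M ∧ ‖lam k‖ ≤ M) ∧
    ∃ C : ℝ, 0 < C ∧ ∀ k : ℕ, 1 ≤ k →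
      L (x k) (y k) ls - L xs ys ls ≤ C / (k : ℝ) ^ 2 ∧
      |f (x k) + g (y k) - (f xs + g ys)| ≤ C / (k : ℝ) ^ 2 ∧
      ‖A (x k) + B (y k) - b‖ ≤ C / (k : ℝ) ^ 2 := by
  have hBpos : 0 < ‖B‖ := norm_pos_iff.mpr hB0
  obtain ⟨c, hcdef⟩ : ∃ c, c = μg / (3 * ‖B‖ ^ 2) := ⟨_, rfl⟩
  have hc : 0 < c := by rw [hcdef]; positivity
  have hcB : c * ‖B‖ ^ 2 = μg / 3 := by rw [hcdef]; field_simp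
  have hαβ : ∀ k : ℕ, 1 ≤ k → α k * β k = c * k := by
    intro k hk
    have : (0 : ℝ) < k := by exact_mod_cast hk
    rw [hαdef k hk, hβdef k hk, hcdef]
    field_simp
  have hce : ∀ k : ℕ, 1 ≤ k → c * k * ε k = 1 / (k : ℝ) ^ 3 := by
    intro k hk
    have : (0 : ℝ) < k := by exact_mod_cast hk
    rw [hεdef k hk, hαβ k hk]
    field_simp
  have hα' : ∀ k : ℕ, 1 ≤ k → 1 / α k = k := by
    intro k hk
    rw [hαdef k hk, one_div_one_div]
  have hfeas : A xs + B ys = b := by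
    have h := (hsaddle xs ys (ls + (A xs + B ys - b))).1
    rw [hL, hL, inner_add_left, real_inner_self_eq_norm_sq] at h
    have h0 : ‖A xs + B ys - b‖ ^ 2 = 0 := le_antisymm (by linarith) (sq_nonneg _)
    exact sub_eq_zero.mp (norm_eq_zero.mp (pow_eq_zero_iff two_ne_zero |>.mp h0))
  have hgapeq : ∀ k, L (x k) (y k) ls - L xs ys ls
      = f (x k) + g (y k) - (f xs + g ys) + ⟪ls, A (x k) + B (y k) - b⟫ := by
    intro k
    rw [hL, hL, hfeas, sub_self, inner_zero_right]
    ring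
  have hgap : ∀ k, 0 ≤ f (x k) + g (y k) - (f xs + g ys) + ⟪ls, A (x k) + B (y k) - b⟫ := by
    intro k
    rw [← hgapeq]
    exact sub_nonneg.mpr (hsaddle (x k) (y k) ls).2
  have hZd' : ∀ k : ℕ, 1 ≤ k → Zd (k + 1) = x (k + 1) + (δ * k) • (x (k + 1) - x k) := by
    intro k hk
    rw [hZd k hk, hZ k hk, hα' k hk]
    module
  have hHd' : ∀ k : ℕ, 1 ≤ k → Hd (k + 1) = y (k + 1) + (δ * k) • (y (k + 1) - y k) := by
    intro k hk
    rw [hHd k hk, hH k hk, hα' k hk]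
    module
  have hlam' : ∀ k : ℕ, 1 ≤ k →
      lam (k + 1) = lam k + (c * k) • (A (Zd (k + 1)) + B (Hd (k + 1)) - b) := by
    intro k hk
    rw [hlam k hk, hαβ k hk]
  obtain ⟨E, hE⟩ : ∃ E : ℕ → ℝ, ∀ k, E k = 1 / 2 * ‖Zd k - xs‖ ^ 2 + 1 / 2 * ‖Hd k - ys‖ ^ 2
        + (δ * γ - 1) / 2 * (‖x k - xs‖ ^ 2 + ‖y k - ys‖ ^ 2)
        + δ ^ 2 * c * (k : ℝ) ^ 2
          * (f (x k) + g (y k) - (f xs + g ys) + ⟪ls, A (x k) + B (y k) - b⟫)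
        + δ ^ 2 / (2 * (k : ℝ) ^ 2) * (‖x k‖ ^ 2 + ‖y k‖ ^ 2)
        + δ / 2 * ‖lam k - ls‖ ^ 2 + δ * (c * k) ^ 2 / 2 * ‖B (Hd k - ys)‖ ^ 2 :=
    ⟨_, fun _ => rfl⟩
  have hEstep : ∀ k : ℕ, 2 ≤ k →
      E (k + 1) ≤ E k + δ / 2 * (‖xs‖ ^ 2 + ‖ys‖ ^ 2) / (k : ℝ) ^ 3 := by
    intro k hk
    have hk1 : 1 ≤ k := by omega
    have hkR : (1 : ℝ) ≤ k := by exact_mod_cast hk1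
    obtain ⟨u, v, hu, hv, hsx, hsy⟩ := hstep k hk1
    obtain ⟨j, rfl⟩ : ∃ j, k = j + 1 := ⟨k - 1, by omega⟩
    have hj : 1 ≤ j := by omega
    have hαpos : α (j + 1) ≠ 0 := by
      rw [hαdef _ hk1]
      positivity
    rw [one_div, inv_smul_eq_iff₀ hαpos, smul_neg, smul_smul, hαβ _ hk1] at hsx hsy
    have hx : Zd (j + 1 + 1) - Zd (j + 1) = -((δ * (c * ((j + 1 : ℕ) : ℝ))) • (u
        + ContinuousLinearMap.adjoint A (lam (j + 1)
          + (c * ((j + 1 : ℕ) : ℝ)) • (A (Zd (j + 1 + 1)) + B (Hd (j + 1)) - b))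
        + ε (j + 1) • x (j + 1 + 1) + μf • (Zd (j + 1 + 1) - x (j + 1 + 1))))
        - (δ * γ - 1) • (x (j + 1 + 1) - x (j + 1)) := by
      have : Zd (j + 1 + 1) - Zd (j + 1) = δ • (Zs (j + 1 + 1) - Zs (j + 1))
          - (δ * γ - 1) • (x (j + 1 + 1) - x (j + 1)) := by
        rw [hZd _ hk1, hZd _ hj]
        module
      rw [this, hsx]
      module
    have hy : Hd (j + 1 + 1) - Hd (j + 1) = -((δ * (c * ((j + 1 : ℕ) : ℝ))) • (v
        + ContinuousLinearMap.adjoint B (lam (j + 1 + 1))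
        + ε (j + 1) • y (j + 1 + 1) + μg • (Hd (j + 1 + 1) - y (j + 1 + 1))))
        - (δ * γ - 1) • (y (j + 1 + 1) - y (j + 1)) := by
      have : Hd (j + 1 + 1) - Hd (j + 1) = δ • (Hs (j + 1 + 1) - Hs (j + 1))
          - (δ * γ - 1) • (y (j + 1 + 1) - y (j + 1)) := by
        rw [hHd _ hk1, hHd _ hj]
        module
      rw [this, hsy]
      module
    have := energy_step hδ hδ13 hkR hc hμf hμg hδγ (hce _ hk1) hcB hfeas (hZd' _ hk1)
      (hHd' _ hk1) (hlam' _ hk1) hx hy (hfS _ _ _ hu) (hfS _ _ _ hu) (hgS _ _ _ hv)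
      (hgS _ _ _ hv) (hgap _)
    rw [hE, hE, Nat.cast_add (j + 1) 1, Nat.cast_one]
    exact this
  have hEbd := exists_bound_of_le_add_div_cube (by positivity) hEstep
  obtain ⟨K, hK⟩ : ∃ K, K = E 2 + δ / 2 * (‖xs‖ ^ 2 + ‖ys‖ ^ 2) := ⟨_, rfl⟩
  rw [← hK] at hEbd
  have hpart : ∀ k : ℕ, 2 ≤ k → ‖Zd k - xs‖ ^ 2 ≤ 2 * K ∧ ‖Hd k - ys‖ ^ 2 ≤ 2 * K ∧
      ‖lam k - ls‖ ^ 2 ≤ 2 * K / δ ∧ (k : ℝ) ^ 2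
        * (f (x k) + g (y k) - (f xs + g ys) + ⟪ls, A (x k) + B (y k) - b⟫)
        ≤ K / (δ ^ 2 * c) := by
    intro k hk
    have hb := hEbd k hk
    rw [hE] at hb
    have h1 : 0 ≤ 1 / 2 * ‖Zd k - xs‖ ^ 2 := by positivity
    have h2 : 0 ≤ 1 / 2 * ‖Hd k - ys‖ ^ 2 := by positivity
    have h3 : 0 ≤ (δ * γ - 1) / 2 * (‖x k - xs‖ ^ 2 + ‖y k - ys‖ ^ 2) :=
      mul_nonneg (by linarith) (by positivity)
    have h4 : 0 ≤ δ ^ 2 * c * (k : ℝ) ^ 2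
        * (f (x k) + g (y k) - (f xs + g ys) + ⟪ls, A (x k) + B (y k) - b⟫) :=
      mul_nonneg (by positivity) (hgap k)
    have h5 : 0 ≤ δ ^ 2 / (2 * (k : ℝ) ^ 2) * (‖x k‖ ^ 2 + ‖y k‖ ^ 2) := by positivity
    have h6 : 0 ≤ δ / 2 * ‖lam k - ls‖ ^ 2 := by positivity
    have h7 : 0 ≤ δ * (c * k) ^ 2 / 2 * ‖B (Hd k - ys)‖ ^ 2 := by positivity
    refine ⟨by linarith, by linarith, ?_, ?_⟩
    · rw [le_div_iff₀ hδ]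
      linarith
    · rw [le_div_iff₀ (by positivity)]
      linarith
  have hlamM : ∀ k : ℕ, 2 ≤ k → ‖lam k‖ ≤ ‖ls‖ + √(2 * K / δ) := fun k hk =>
    (norm_le_norm_add_norm_sub' _ ls).trans
      (add_le_add_right (Real.le_sqrt_of_sq_le (hpart k hk).2.2.1) _)
  have hxM : ∃ M, ∀ k : ℕ, 2 ≤ k → ‖x k‖ ≤ M := by
    refine ⟨max (‖xs‖ + √(2 * K)) ‖x 2‖, norm_le_of_averaging_s8 (a := fun k => δ * k)
      (b := fun _ => 1) (z := fun k => Zd (k + 1)) ?_ ?_ ?_ ?_ ?_ (le_max_right _ _)⟩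
    · intro k _; positivity
    · intro k _; positivity
    · intro k _; positivity
    · intro k hk
      simp only [hZd' k (by omega)]
      module
    · intro k hk
      exact ((norm_le_norm_add_norm_sub' _ xs).trans (add_le_add_right
        (Real.le_sqrt_of_sq_le (hpart (k + 1) (by omega)).1) _)).trans (le_max_left _ _)
  have hyM : ∃ M, ∀ k : ℕ, 2 ≤ k → ‖y k‖ ≤ M := by
    refine ⟨max (‖ys‖ + √(2 * K)) ‖y 2‖, norm_le_of_averaging_s8 (a := fun k => δ * k)
      (b := fun _ => 1) (z := fun k => Hd (k + 1)) ?_ ?_ ?_ ?_ ?_ (le_max_right _ _)⟩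
    · intro k _; positivity
    · intro k _; positivity
    · intro k _; positivity
    · intro k hk
      simp only [hHd' k (by omega)]
      module
    · intro k hk
      exact ((norm_le_norm_add_norm_sub' _ ys).trans (add_le_add_right
        (Real.le_sqrt_of_sq_le (hpart (k + 1) (by omega)).2.1) _)).trans (le_max_left _ _)
  have hrM : ∃ R, ∀ k : ℕ, 2 ≤ k → (k : ℝ) ^ 2 * ‖A (x k) + B (y k) - b‖ ≤ R := by
    refine feasibility_bound (l := lam) hδ hδ13 hc (fun k hk => ?_) hlamM
    rw [hlam' k (by omega), hZd' k (by omega), hHd' k (by omega)]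
    simp only [map_sub, map_add, map_smul]
    module
  obtain ⟨M₁, hM₁⟩ := exists_bound_of_exists_tail_bound hxM
  obtain ⟨M₂, hM₂⟩ := exists_bound_of_exists_tail_bound hyM
  obtain ⟨M₃, hM₃⟩ := exists_bound_of_exists_tail_bound ⟨_, hlamM⟩
  obtain ⟨R, hR⟩ := exists_bound_of_exists_tail_bound hrM
  obtain ⟨S, hS⟩ := exists_bound_of_exists_tail_bound ⟨_, fun k hk => (hpart k hk).2.2.2⟩
  refine ⟨⟨max M₁ (max M₂ M₃), fun k hk => ⟨(hM₁ k hk).trans (le_max_left _ _),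
    (hM₂ k hk).trans ((le_max_left _ _).trans (le_max_right _ _)),
    (hM₃ k hk).trans ((le_max_right _ _).trans (le_max_right _ _))⟩⟩, ?_⟩
  have hR0 : 0 ≤ R := le_trans (by positivity) (hR 1 le_rfl)
  have hS0 : 0 ≤ S := le_trans (mul_nonneg (by positivity) (hgap 1)) (hS 1 le_rfl)
  have hlR : 0 ≤ ‖ls‖ * R := by positivity
  refine ⟨S + ‖ls‖ * R + R + 1, by positivity, fun k hk => ?_⟩
  have hk2 : (0 : ℝ) < (k : ℝ) ^ 2 := by
    have : (0 : ℝ) < k := by exact_mod_cast hk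
    positivity
  have hin := abs_real_inner_le_norm ls (A (x k) + B (y k) - b)
  have hin' : (k : ℝ) ^ 2 * |⟪ls, A (x k) + B (y k) - b⟫| ≤ ‖ls‖ * R :=
    calc (k : ℝ) ^ 2 * |⟪ls, A (x k) + B (y k) - b⟫|
        ≤ (k : ℝ) ^ 2 * (‖ls‖ * ‖A (x k) + B (y k) - b‖) := by gcongr
      _ = ‖ls‖ * ((k : ℝ) ^ 2 * ‖A (x k) + B (y k) - b‖) := by ring
      _ ≤ ‖ls‖ * R := mul_le_mul_of_nonneg_left (hR k hk) (norm_nonneg _)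
  have hSk := hS k hk
  have hRk := hR k hk
  refine ⟨?_, ?_, ?_⟩
  · rw [hgapeq, le_div_iff₀ hk2]
    linarith
  · rw [le_div_iff₀ hk2]
    have h1 : |f (x k) + g (y k) - (f xs + g ys)|
        ≤ (f (x k) + g (y k) - (f xs + g ys) + ⟪ls, A (x k) + B (y k) - b⟫)
          + |⟪ls, A (x k) + B (y k) - b⟫| := by
      have h := abs_sub (f (x k) + g (y k) - (f xs + g ys) + ⟪ls, A (x k) + B (y k) - b⟫)
        ⟪ls, A (x k) + B (y k) - b⟫
      rwa [add_sub_cancel_right, abs_of_nonneg (hgap k)] at h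
    have h2 := mul_le_mul_of_nonneg_left h1 hk2.le
    linarith
  · rw [le_div_iff₀ hk2]
    linarith
end
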